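/- arXiv:2409.09303 — 6 statements merged into one kernel-verified Lean document; each statement's English description precedes it below -/
import Mathlib

section
/- Let H be a real separable Hilbert space and let μ be a centered Borel probability measure on H such that ∫_H ‖u‖^k dμ(u) < ∞ for every k ∈ ℕ, ∫_H ⟨h,u⟩² dμ(u) > 0 for every h ≠ 0, and there exists a constant c > 0 with ∫_H ⟨h,u⟩⁴ dμ(u) ≤ c² (∫_H ⟨h,u⟩² dμ(u))² for every h ∈ H (this fourth-moment comparison is the consequence of polynomial non-degeneracy of μ used in the proof). Let {μ_α, α ∈ Θ} be a family of Borel probability measures on H such that: (1) each μ_α has finite moments of all orders of the norm; (2) each μ_α is finitely absolutely continuous with respect to μ with constants (c_n^α)_{n≥0}; (3) for every n, sup_{α∈Θ} c_n^α < ∞. Then the family {μ_α, α ∈ Θ} is relatively compact in the topology of weak convergence of probability measures (equivalently, uniformly tight). -/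
open MeasureTheory ProbabilityTheory Real Filter
open scoped NNReal ENNReal RealInnerProductSpace

noncomputable section

/-- `ν` is finitely absolutely continuous with respect to `μ` with constants `c`:
for every `n`, every polynomial `P` in `n` variables of total degree at most `n` and
all continuous linear functionals `ℓ₁, …, ℓₙ`,
`|∫ P(ℓ₁(ω),…,ℓₙ(ω)) dν| ≤ c n * (∫ P(ℓ₁(ω),…,ℓₙ(ω))² dμ)^(1/2)`. -/
def FinAbsCont {B : Type*} [NormedAddCommGroup B] [NormedSpace ℝ B] [MeasurableSpace B]
    (ν μ : Measure B) (c : ℕ → ℝ) : Prop :=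
  ∀ (n : ℕ) (P : MvPolynomial (Fin n) ℝ), P.totalDegree ≤ n →
    ∀ ℓ : Fin n → (B →L[ℝ] ℝ),
      |∫ ω, MvPolynomial.eval (fun i => ℓ i ω) P ∂ν| ≤
        c n * (∫ ω, (MvPolynomial.eval (fun i => ℓ i ω) P) ^ 2 ∂μ) ^ (1 / 2 : ℝ)

section Helpers

variable {H : Type*} [NormedAddCommGroup H] [InnerProductSpace ℝ H]

lemma aux_countable {ι : Type*} [TopologicalSpace.SeparableSpace H]
    (b : ι → H) (hb : Orthonormal ℝ b) : Countable ι := by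
  refine Pairwise.countable_of_isOpen_disjoint (s := fun i => Metric.ball (b i) (1 / 2)) ?_
    (fun i => Metric.isOpen_ball) (fun i => ⟨b i, Metric.mem_ball_self (by norm_num)⟩)
  intro i j hij
  apply Metric.ball_disjoint_ball
  have h1 : ‖b i - b j‖ ^ 2 = 2 := by
    rw [@norm_sub_sq_real, hb.1 i, hb.1 j, hb.2 hij]; norm_num
  rw [dist_eq_norm]
  nlinarith [norm_nonneg (b i - b j)]

lemma aux_norm {ι : Type*} (b : HilbertBasis ι ℝ H) (u : H) :
    ∑' i, ENNReal.ofReal (⟪b i, u⟫ ^ 2) = ENNReal.ofReal (‖u‖ ^ 2) := by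
  have h := b.hasSum_inner_mul_inner u u
  have e : (fun i => ⟪u, b i⟫ * ⟪b i, u⟫) = fun i => ⟪b i, u⟫ ^ 2 := by
    ext i; rw [real_inner_comm, sq]
  rw [e, real_inner_self_eq_norm_sq] at h
  rw [← h.tsum_eq, ENNReal.ofReal_tsum_of_nonneg (fun i => sq_nonneg _) h.summable]

lemma aux_integrable [MeasurableSpace H] [BorelSpace H] (ν : Measure H)
    [TopologicalSpace.SeparableSpace H]
    (hm : Integrable (fun u => ‖u‖ ^ 2) ν) (h : H) : Integrable (fun u => ⟪h, u⟫ ^ 2) ν := by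
  refine (hm.const_mul (‖h‖ ^ 2)).mono' (by fun_prop) (Eventually.of_forall fun u => ?_)
  rw [Real.norm_eq_abs, abs_of_nonneg (sq_nonneg _), ← mul_pow, ← sq_abs]
  gcongr
  exact abs_real_inner_le_norm h u

lemma aux_moment [MeasurableSpace H]
    (μ ν : Measure H) (c : ℝ) (hc : 0 < c)
    (h4 : ∀ h : H, ∫ u, ⟪h, u⟫ ^ 4 ∂μ ≤ c ^ 2 * (∫ u, ⟪h, u⟫ ^ 2 ∂μ) ^ 2)
    (cα : ℕ → ℝ) (hf : FinAbsCont ν μ cα) (C : ℝ) (hC0 : 0 ≤ C) (hC : cα 2 ≤ C) (h : H) :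
    ∫ u, ⟪h, u⟫ ^ 2 ∂ν ≤ C * c * ∫ u, ⟪h, u⟫ ^ 2 ∂μ := by
  have h1 := hf 2 (MvPolynomial.X 0 ^ 2) (by
    simp [MvPolynomial.totalDegree_X_pow]) (fun _ => innerSL ℝ h)
  simp only [map_pow, MvPolynomial.eval_X, innerSL_apply_apply, ← pow_mul] at h1
  norm_num at h1
  have hσ : 0 ≤ ∫ u, ⟪h, u⟫ ^ 2 ∂μ := integral_nonneg fun u => sq_nonneg _
  have h40 : 0 ≤ ∫ u, ⟪h, u⟫ ^ 4 ∂μ := integral_nonneg fun u => by positivity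
  refine (le_abs_self _).trans (h1.trans ?_)
  rw [← Real.sqrt_eq_rpow]
  have : √(∫ u, ⟪h, u⟫ ^ 4 ∂μ) ≤ c * ∫ u, ⟪h, u⟫ ^ 2 ∂μ := by
    apply Real.sqrt_le_iff.2
    refine ⟨by positivity, ?_⟩
    rw [mul_pow]; exact h4 h
  rw [mul_assoc]
  exact mul_le_mul hC this (Real.sqrt_nonneg _) hC0

lemma aux_tb {ι : Type*} (b : HilbertBasis ι ℝ H) (s : ℕ → Finset ι) (R : ℝ) :
    TotallyBounded {u : H | ‖u‖ ^ 2 ≤ R ^ 2 ∧ ∀ m : ℕ,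
      ∑' i : {x // x ∉ s m}, ENNReal.ofReal (⟪b i, u⟫ ^ 2)
        < ENNReal.ofReal ((1 / ((m : ℝ) + 1)) ^ 2)} := by
  classical
  rw [Metric.totallyBounded_iff]
  intro ε hε
  obtain ⟨m, hm⟩ := exists_nat_one_div_lt (half_pos hε)
  let Q : Set H := (fun a : ι → ℝ => ∑ i ∈ s m, a i • b i) ''
    (Set.univ.pi fun _ => Set.Icc (-|R|) |R|)
  have hQ : IsCompact Q :=
    (isCompact_univ_pi fun _ => isCompact_Icc).image (by fun_prop)
  obtain ⟨t, ht, hcov⟩ := Metric.totallyBounded_iff.1 hQ.totallyBounded (ε / 2) (half_pos hε)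
  refine ⟨t, ht, ?_⟩
  rintro u ⟨hu1, hu2⟩
  set v : H := ∑ i ∈ s m, ⟪b i, u⟫ • b i with hv
  have hvQ : v ∈ Q := by
    refine ⟨fun i => ⟪b i, u⟫, fun i _ => ?_, rfl⟩
    have h1 : |⟪b i, u⟫| ≤ |R| := by
      refine (abs_real_inner_le_norm _ _).trans ?_
      rw [b.orthonormal.1 i, one_mul, ← abs_of_nonneg (norm_nonneg u)]
      exact sq_le_sq.1 hu1
    exact ⟨(abs_le.1 h1).1, (abs_le.1 h1).2⟩
  have hin : ∀ i, ⟪b i, u - v⟫ = if i ∈ s m then 0 else ⟪b i, u⟫ := by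
    intro i
    rw [inner_sub_right, hv, inner_sum]
    simp only [inner_smul_right, orthonormal_iff_ite.1 b.orthonormal]
    simp only [mul_ite, mul_one, mul_zero, Finset.sum_ite_eq]
    split_ifs <;> simp
  have huv : ENNReal.ofReal (‖u - v‖ ^ 2) < ENNReal.ofReal ((1 / ((m : ℝ) + 1)) ^ 2) := by
    rw [← aux_norm b]
    refine lt_of_eq_of_lt ?_ (hu2 m)
    refine Eq.trans ?_
      (tsum_subtype {x | x ∉ s m} (fun i => ENNReal.ofReal (⟪b i, u⟫ ^ 2))).symm
    refine tsum_congr fun i => ?_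
    rw [hin]
    by_cases hi : i ∈ s m <;> simp [hi]
  have huv2 : ‖u - v‖ < ε / 2 := by
    have := (ENNReal.ofReal_lt_ofReal_iff (by positivity)).1 huv
    exact (lt_of_pow_lt_pow_left₀ 2 (by positivity) this).trans hm
  obtain ⟨y, hy, hvy⟩ := Set.mem_iUnion₂.1 (hcov hvQ)
  refine Set.mem_iUnion₂.2 ⟨y, hy, ?_⟩
  rw [Metric.mem_ball] at hvy ⊢
  have := dist_triangle u v y
  rw [dist_eq_norm u v] at this
  linarith

lemma aux_tight [CompleteSpace H] [TopologicalSpace.SeparableSpace H]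
    [MeasurableSpace H] [BorelSpace H]
    (μ : Measure H) (hm : Integrable (fun u => ‖u‖ ^ 2) μ) (S : Set (Measure H))
    (hS : ∀ ν ∈ S, Integrable (fun u => ‖u‖ ^ 2) ν) (C : ℝ) (hC : 0 ≤ C)
    (hle : ∀ ν ∈ S, ∀ h : H, ∫ u, ⟪h, u⟫ ^ 2 ∂ν ≤ C * ∫ u, ⟪h, u⟫ ^ 2 ∂μ) :
    IsTightMeasureSet S := by
  obtain ⟨w, b, -⟩ := exists_hilbertBasis ℝ H
  have : Countable w := aux_countable _ b.orthonormal
  let σ : w → ℝ≥0∞ := fun i => ENNReal.ofReal C * ∫⁻ u, ENNReal.ofReal (⟪b i, u⟫ ^ 2) ∂μ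
  have hmeas : ∀ i, Measurable fun u : H => ENNReal.ofReal (⟪b i, u⟫ ^ 2) := fun i => by fun_prop
  have hσ : ∀ ν ∈ S, ∀ i, ∫⁻ u, ENNReal.ofReal (⟪b i, u⟫ ^ 2) ∂ν ≤ σ i := by
    intro ν hν i
    simp only [σ]
    rw [← ofReal_integral_eq_lintegral_ofReal (aux_integrable ν (hS ν hν) _)
      (Eventually.of_forall fun u => sq_nonneg _),
      ← ofReal_integral_eq_lintegral_ofReal (aux_integrable μ hm _)
      (Eventually.of_forall fun u => sq_nonneg _), ← ENNReal.ofReal_mul hC]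
    exact ENNReal.ofReal_le_ofReal (hle ν hν _)
  have hσsum : ∑' i, σ i ≠ ∞ := by
    simp only [σ]
    rw [ENNReal.tsum_mul_left, ← lintegral_tsum fun i => (hmeas i).aemeasurable]
    simp_rw [aux_norm b]
    exact ENNReal.mul_ne_top ENNReal.ofReal_ne_top hm.lintegral_lt_top.ne
  have htail : ∀ ν ∈ S, ∀ s : Finset w,
      ∫⁻ u, ∑' i : {x // x ∉ s}, ENNReal.ofReal (⟪b i, u⟫ ^ 2) ∂ν ≤ ∑' i : {x // x ∉ s}, σ i := by
    intro ν hν s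
    rw [lintegral_tsum fun i => (hmeas _).aemeasurable]
    exact ENNReal.tsum_le_tsum fun i => hσ ν hν i
  rw [isTightMeasureSet_iff_exists_isCompact_measure_compl_le]
  intro ε hε
  have hε2 : ε / 2 ≠ 0 := (ENNReal.half_pos hε.ne').ne'
  obtain ⟨η, hη, hηs⟩ := ENNReal.exists_pos_sum_of_countable' hε2 ℕ
  let t : ℕ → ℝ≥0∞ := fun m => ENNReal.ofReal ((1 / ((m : ℝ) + 1)) ^ 2)
  have ht0 : ∀ m, t m ≠ 0 := fun m => by
    simp only [t, ne_eq, ENNReal.ofReal_eq_zero, not_le]; positivity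
  have hex : ∀ m, ∃ s : Finset w, ∑' i : {x // x ∉ s}, σ i < η m * t m := fun m =>
    ((tendsto_order.1 (ENNReal.tendsto_tsum_compl_atTop_zero hσsum)).2 _
      (ENNReal.mul_pos (hη m).ne' (ht0 m))).exists
  choose s hs using hex
  obtain ⟨R, hR, hRσ⟩ : ∃ R : ℝ, 0 < R ∧ ∑' i, σ i ≤ ε / 2 * ENNReal.ofReal (R ^ 2) := by
    obtain ⟨n, hn⟩ := ENNReal.exists_nat_mul_gt hε2 hσsum
    refine ⟨(n : ℝ) + 1, by positivity, hn.le.trans ?_⟩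
    rw [mul_comm]
    gcongr
    rw [← ENNReal.ofReal_natCast]
    apply ENNReal.ofReal_le_ofReal
    nlinarith [(Nat.cast_nonneg n : (0 : ℝ) ≤ n)]
  have htb := aux_tb b s R
  refine ⟨closure _, isCompact_iff_totallyBounded_isComplete.2
    ⟨htb.closure, isClosed_closure.isComplete⟩, ?_⟩
  intro ν hν
  refine (measure_mono (Set.compl_subset_compl.2 subset_closure)).trans ?_
  have hsub : {u : H | ‖u‖ ^ 2 ≤ R ^ 2 ∧ ∀ m : ℕ,
      ∑' i : {x // x ∉ s m}, ENNReal.ofReal (⟪b i, u⟫ ^ 2) < t m}ᶜ ⊆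
      {u | ENNReal.ofReal (R ^ 2) ≤ ENNReal.ofReal (‖u‖ ^ 2)} ∪
      ⋃ m, {u | t m ≤ ∑' i : {x // x ∉ s m}, ENNReal.ofReal (⟪b i, u⟫ ^ 2)} := by
    intro u hu
    by_contra hcon
    simp only [Set.mem_union, Set.mem_iUnion, Set.mem_setOf_eq, not_or, not_exists, not_le] at hcon
    exact hu ⟨((ENNReal.ofReal_lt_ofReal_iff_of_nonneg (sq_nonneg _)).1 hcon.1).le, hcon.2⟩
  refine (measure_mono hsub).trans ((measure_union_le _ _).trans ?_)
  rw [← ENNReal.add_halves ε]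
  gcongr
  · refine (meas_ge_le_lintegral_div (by fun_prop) (by
      simp only [ne_eq, ENNReal.ofReal_eq_zero, not_le]; positivity) ENNReal.ofReal_ne_top).trans ?_
    apply ENNReal.div_le_of_le_mul
    refine le_trans ?_ hRσ
    simp_rw [← aux_norm b]
    rw [lintegral_tsum fun i => (hmeas i).aemeasurable]
    exact ENNReal.tsum_le_tsum fun i => hσ ν hν i
  · refine (measure_iUnion_le _).trans (le_trans (ENNReal.tsum_le_tsum fun m => ?_) hηs.le)
    refine (meas_ge_le_lintegral_div
      (Measurable.ennreal_tsum fun i => hmeas _).aemeasurable (ht0 m) ENNReal.ofReal_ne_top).trans ?_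
    exact ENNReal.div_le_of_le_mul ((htail ν hν (s m)).trans (hs m).le)

end Helpers

/-- a family of probability measures on a separable Hilbert space which is
uniformly finitely absolutely continuous with respect to a fixed polynomially
non-degenerate centered measure `μ` is relatively compact in the topology of weak
convergence. -/
theorem weak_compactness_of_uniform_finAbsCont_hilbert
    {H : Type*} [NormedAddCommGroup H] [InnerProductSpace ℝ H] [CompleteSpace H]
    [TopologicalSpace.SeparableSpace H] [MeasurableSpace H] [BorelSpace H]
    (μ : Measure H) [IsProbabilityMeasure μ]
    -- μ has all moments of the norm
    (hmom : ∀ k : ℕ, Integrable (fun u => ‖u‖ ^ k) μ)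
    -- μ is centered
    (hcen : ∀ h : H, ∫ u, ⟪h, u⟫ ∂μ = 0)
    -- non-degeneracy of second moments
    (hnd : ∀ h : H, h ≠ 0 → 0 < ∫ u, ⟪h, u⟫ ^ 2 ∂μ)
    -- the fourth moment comparison (consequence of polynomial non-degeneracy)
    (c : ℝ) (hc : 0 < c)
    (h4 : ∀ h : H, ∫ u, ⟪h, u⟫ ^ 4 ∂μ ≤ c ^ 2 * (∫ u, ⟪h, u⟫ ^ 2 ∂μ) ^ 2)
    {Θ : Type*} (μα : Θ → ProbabilityMeasure H)
    -- each μα has all moments of the norm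
    (hαmom : ∀ (α : Θ) (k : ℕ), Integrable (fun u => ‖u‖ ^ k) (μα α : Measure H))
    (cα : Θ → ℕ → ℝ)
    -- each μα is finitely absolutely continuous w.r.t. μ with constants cα α
    (hfac : ∀ α : Θ, FinAbsCont (μα α : Measure H) μ (cα α))
    -- uniform finiteness of the constants
    (hsup : ∀ n : ℕ, BddAbove (Set.range fun α => cα α n)) :
    IsCompact (closure (Set.range μα)) := by
  obtain ⟨C, hC⟩ := hsup 2
  apply isCompact_closure_of_isTightMeasureSet
  refine aux_tight μ (hmom 2) _ ?_ (max C 0 * c) (by positivity) ?_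
  · rintro _ ⟨ν, ⟨α, rfl⟩, rfl⟩
    exact hαmom α 2
  · rintro _ ⟨ν, ⟨α, rfl⟩, rfl⟩ h
    exact aux_moment μ _ c hc h4 (cα α) (hfac α) _ (le_max_right _ _)
      ((hC ⟨α, rfl⟩).trans (le_max_left _ _)) h
end
end

section
/- Let B = C([0,1], ℝ^d) with the supremum norm and let μ be a centered Borel probability measure on B such that: ∫_B ‖u‖_∞^k dμ(u) < ∞ for all k ∈ ℕ; for every m ≥ 1 there exists a_m > 0 such that ∫_B φ(u)^{2m} dμ(u) ≤ a_m (∫_B φ(u)² dμ(u))^m for every φ ∈ B* (this moment comparison is the consequence of polynomial non-degeneracy of μ used in the proof); and there exist c > 0 and γ > 0 with ∫_B ‖u(t₂) − u(t₁)‖² dμ(u) ≤ c |t₂ − t₁|^γ for all t₁, t₂ ∈ [0,1]. Let {μ_α, α ∈ Θ} be a family of Borel probability measures on B such that each μ_α has finite moments of all orders of the norm, each μ_α is finitely absolutely continuous with respect to μ with constants (c_n^α)_{n≥0}, and sup_{α∈Θ} c_n^α < ∞ for every n. Then the family {μ_α, α ∈ Θ} is relatively compact in the topology of weak convergence of probability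 measures on B. -/
open MeasureTheory ProbabilityTheory Real Filter
open scoped NNReal ENNReal

noncomputable section

/-- The space `C([0,1], ℝ^d)` with the supremum norm. -/
abbrev PathSpace (d : ℕ) := C(Set.Icc (0 : ℝ) 1, EuclideanSpace ℝ (Fin d))

instance (d : ℕ) : MeasurableSpace (PathSpace d) := borel _
instance (d : ℕ) : BorelSpace (PathSpace d) := ⟨rfl⟩

theorem aux_grid_step (t : ℝ) (ht : 0 ≤ t) (n : ℕ) :
    ⌊t * 2 ^ (n + 1)⌋₊ = 2 * ⌊t * 2 ^ n⌋₊ ∨ ⌊t * 2 ^ (n + 1)⌋₊ = 2 * ⌊t * 2 ^ n⌋₊ + 1 := by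
  have h0 : 0 ≤ t * 2 ^ n := by positivity
  have h1 := Nat.floor_le h0
  have h2 := Nat.lt_floor_add_one (t * 2 ^ n)
  have h3 : 2 * ⌊t * 2 ^ n⌋₊ ≤ ⌊t * 2 ^ (n + 1)⌋₊ := by
    apply Nat.le_floor
    push_cast
    rw [pow_succ]
    linarith
  have h4 : ⌊t * 2 ^ (n + 1)⌋₊ < 2 * ⌊t * 2 ^ n⌋₊ + 2 := by
    rw [Nat.floor_lt (by positivity)]
    push_cast
    rw [pow_succ]
    linarith
  omega

theorem aux_chain {E : Type*} [PseudoMetricSpace E] (f : ℝ → E) (hf : Continuous f) (A r : ℝ)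
    (hA : 0 ≤ A) (hr0 : 0 ≤ r) (hr1 : r < 1)
    (h : ∀ n k : ℕ, dist (f (k / 2 ^ n)) (f ((k + 1 : ℕ) / 2 ^ n)) ≤ A * r ^ n)
    (n : ℕ) (s t : ℝ) (hs : 0 ≤ s) (hst : s ≤ t) (hn : t - s ≤ (1 / 2) ^ n) :
    dist (f s) (f t) ≤ A * (1 + 2 / (1 - r)) * r ^ n := by
  have key : ∀ t : ℝ, 0 ≤ t → dist (f (⌊t * 2 ^ n⌋₊ / 2 ^ n)) (f t) ≤ A * r ^ n / (1 - r) := by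
    intro t ht
    refine dist_le_of_le_geometric_of_tendsto (f := fun n : ℕ => f (⌊t * 2 ^ n⌋₊ / 2 ^ n)) r A hr1 ?_ ?_ n
    · intro j
      have e : (⌊t * 2 ^ j⌋₊ : ℝ) / 2 ^ j = ((2 * ⌊t * 2 ^ j⌋₊ : ℕ) : ℝ) / 2 ^ (j + 1) := by
        push_cast
        rw [pow_succ]
        field_simp
      rw [e]
      rcases aux_grid_step t ht j with h1 | h1
      · rw [h1, dist_self]; positivity
      · rw [h1]
        refine (h (j + 1) (2 * ⌊t * 2 ^ j⌋₊)).trans ?_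
        exact mul_le_mul_of_nonneg_left (pow_le_pow_of_le_one hr0 hr1.le (Nat.le_succ j)) hA
    · refine (hf.tendsto t).comp ?_
      have hp : Tendsto (fun n : ℕ => (2 : ℝ) ^ n) atTop atTop :=
        tendsto_pow_atTop_atTop_of_one_lt (by norm_num)
      exact (tendsto_nat_floor_mul_div_atTop ht).comp hp
  have h1 := key s hs
  have h2 := key t (hs.trans hst)
  have h3 : dist (f (⌊s * 2 ^ n⌋₊ / 2 ^ n)) (f (⌊t * 2 ^ n⌋₊ / 2 ^ n)) ≤ A * r ^ n := by
    have hle : ⌊s * 2 ^ n⌋₊ ≤ ⌊t * 2 ^ n⌋₊ := Nat.floor_mono (by gcongr)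
    have hlt : ⌊t * 2 ^ n⌋₊ ≤ ⌊s * 2 ^ n⌋₊ + 1 := by
      rw [← Nat.floor_add_one (by positivity)]
      apply Nat.floor_mono
      have : (t - s) * 2 ^ n ≤ (1 / 2) ^ n * 2 ^ n := by gcongr
      rw [← mul_pow] at this
      norm_num at this
      linarith
    have : ⌊t * 2 ^ n⌋₊ = ⌊s * 2 ^ n⌋₊ ∨ ⌊t * 2 ^ n⌋₊ = ⌊s * 2 ^ n⌋₊ + 1 := by omega
    rcases this with h4 | h4
    · rw [h4, dist_self]; positivity
    · rw [h4]; exact h n _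
  have h4 := dist_triangle4 (f s) (f (⌊s * 2 ^ n⌋₊ / 2 ^ n)) (f (⌊t * 2 ^ n⌋₊ / 2 ^ n)) (f t)
  rw [dist_comm (f s) (f (⌊s * 2 ^ n⌋₊ / 2 ^ n))] at h4
  have e : A * (1 + 2 / (1 - r)) * r ^ n = A * r ^ n / (1 - r) + A * r ^ n + A * r ^ n / (1 - r) := by
    ring
  linarith

theorem aux_compact (d : ℕ) (R A r : ℝ) (hr0 : 0 ≤ r) (hr1 : r < 1) :
    IsCompact {u : PathSpace d | ‖u 0‖ ≤ R ∧ ∀ (n : ℕ) (s t : Set.Icc (0 : ℝ) 1),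
      dist s t ≤ (1 / 2) ^ n → dist (u s) (u t) ≤ A * r ^ n} := by
  set S := {u : PathSpace d | ‖u 0‖ ≤ R ∧ ∀ (n : ℕ) (s t : Set.Icc (0 : ℝ) 1),
      dist s t ≤ (1 / 2) ^ n → dist (u s) (u t) ≤ A * r ^ n} with hS
  have hclosed : IsClosed S := by
    have : S = {u | ‖u 0‖ ≤ R} ∩ ⋂ (n : ℕ) (s : Set.Icc (0 : ℝ) 1) (t : Set.Icc (0 : ℝ) 1)
        (_ : dist s t ≤ (1 / 2) ^ n), {u | dist (u s) (u t) ≤ A * r ^ n} := by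
      ext u; simp only [hS, Set.mem_inter_iff, Set.mem_iInter]; rfl
    rw [this]
    refine (isClosed_le (by fun_prop) continuous_const).inter ?_
    refine isClosed_iInter fun n => isClosed_iInter fun s => isClosed_iInter fun t =>
      isClosed_iInter fun _ => isClosed_le (by fun_prop) continuous_const
  let e := ContinuousMap.isometryEquivBoundedOfCompact (Set.Icc (0 : ℝ) 1) (EuclideanSpace ℝ (Fin d))
  have hc : IsCompact (e '' S) := by
    refine BoundedContinuousFunction.arzela_ascoli₂ (Metric.closedBall 0 (R + A))
      (isCompact_closedBall _ _) _ (e.toHomeomorph.isClosedMap _ hclosed) ?_ ?_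
    · rintro f x ⟨u, hu, rfl⟩
      have h1 := hu.1
      have h2 := hu.2 0 x 0 (by
        rw [pow_zero, Subtype.dist_eq, Real.dist_eq]
        have := x.2.1
        have := x.2.2
        rw [abs_le]
        constructor <;> simp <;> linarith)
      rw [pow_zero, mul_one] at h2
      rw [mem_closedBall_zero_iff]
      change ‖u x‖ ≤ _
      rw [dist_eq_norm] at h2
      have := norm_add_le (u x - u 0) (u 0)
      rw [sub_add_cancel] at this
      linarith
    · intro x
      rw [Metric.equicontinuousAt_iff]
      intro ε hε
      have ht : Tendsto (fun n : ℕ => A * r ^ n) atTop (nhds (A * 0)) :=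
        (tendsto_pow_atTop_nhds_zero_of_lt_one hr0 hr1).const_mul A
      rw [mul_zero] at ht
      obtain ⟨n, hn⟩ := (ht.eventually (gt_mem_nhds hε)).exists
      refine ⟨(1 / 2) ^ n, by positivity, ?_⟩
      rintro y hy ⟨f, u, hu, rfl⟩
      exact (hu.2 n x y (by rw [dist_comm]; exact hy.le)).trans_lt hn
  have := hc.image e.symm.continuous
  rwa [← Set.image_comp, show (e.symm ∘ e : PathSpace d → PathSpace d) = id from by ext; simp, Set.image_id] at this

/-- Coordinate evaluation functional. -/
def auxEval (d : ℕ) (i : Fin d) (t : Set.Icc (0 : ℝ) 1) : PathSpace d →L[ℝ] ℝ :=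
  (EuclideanSpace.proj i : EuclideanSpace ℝ (Fin d) →L[ℝ] ℝ).comp (ContinuousMap.evalCLM ℝ t)

theorem auxEval_apply (d : ℕ) (i : Fin d) (t : Set.Icc (0 : ℝ) 1) (u : PathSpace d) :
    auxEval d i t u = u t i := rfl

theorem aux_integrable_s2 {d : ℕ} (ν : Measure (PathSpace d))
    (hmom : ∀ k : ℕ, Integrable (fun u => ‖u‖ ^ k) ν) (ℓ : PathSpace d →L[ℝ] ℝ) (k : ℕ) :
    Integrable (fun u => ℓ u ^ k) ν := by
  refine ((hmom k).const_mul (‖ℓ‖ ^ k)).mono' ?_ ?_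
  · have : Continuous fun u => ℓ u ^ k := by fun_prop
    exact this.measurable.aestronglyMeasurable
  · filter_upwards with u
    rw [norm_pow, ← mul_pow]
    gcongr
    exact ℓ.le_opNorm u

theorem aux_moment_s2 {d : ℕ} (μ : Measure (PathSpace d)) 
    (a : ℕ → ℝ) (ha : ∀ m : ℕ, 1 ≤ m → 0 < a m)
    (hcmp : ∀ (m : ℕ), 1 ≤ m → ∀ φ : PathSpace d →L[ℝ] ℝ,
      ∫ u, φ u ^ (2 * m) ∂μ ≤ a m * (∫ u, φ u ^ 2 ∂μ) ^ m)
    {Θ : Type*} (μα : Θ → ProbabilityMeasure (PathSpace d))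
    (cα : Θ → ℕ → ℝ)
    (hfac : ∀ α : Θ, FinAbsCont (μα α : Measure (PathSpace d)) μ (cα α))
    (hsup : ∀ n : ℕ, BddAbove (Set.range fun α => cα α n)) (m : ℕ) (hm : 1 ≤ m) :
    ∃ C : ℝ, 0 ≤ C ∧ ∀ α (ℓ : PathSpace d →L[ℝ] ℝ),
      ∫ u, ℓ u ^ (2 * m) ∂(μα α : Measure (PathSpace d)) ≤ C * (∫ u, ℓ u ^ 2 ∂μ) ^ m := by
  obtain ⟨C, hC⟩ := hsup (2 * m)
  refine ⟨max C 0 * (a (2 * m)) ^ (1 / 2 : ℝ), mul_nonneg (le_max_right _ _) (Real.rpow_nonneg (ha (2 * m) (by omega)).le _), ?_⟩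
  intro α ℓ
  have hca : cα α (2 * m) ≤ max C 0 := (hC ⟨α, rfl⟩).trans (le_max_left _ _)
  have h := hfac α (2 * m) (MvPolynomial.X ⟨0, by omega⟩ ^ (2 * m))
    (MvPolynomial.totalDegree_X_pow _ _).le (fun _ => ℓ)
  simp only [map_pow, MvPolynomial.eval_X, ← pow_mul] at h
  rw [mul_comm (2 * m) 2] at h
  have hV : 0 ≤ ∫ u, ℓ u ^ 2 ∂μ := integral_nonneg fun u => by positivity
  have h0 : 0 ≤ ∫ u, ℓ u ^ (2 * (2 * m)) ∂μ := integral_nonneg fun u => by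
    simp only [pow_mul]; positivity
  have h2 := Real.rpow_le_rpow h0 (hcmp (2 * m) (by omega) ℓ) (by norm_num : (0 : ℝ) ≤ 1 / 2)
  rw [Real.mul_rpow (ha (2 * m) (by omega)).le (by positivity)] at h2
  have e : ((∫ u, ℓ u ^ 2 ∂μ) ^ (2 * m)) ^ (1 / 2 : ℝ) = (∫ u, ℓ u ^ 2 ∂μ) ^ m := by
    rw [mul_comm 2 m, pow_mul, ← Real.sqrt_eq_rpow, Real.sqrt_sq (by positivity)]
  rw [e] at h2
  calc _ ≤ _ := le_abs_self _
    _ ≤ _ := h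
    _ ≤ max C 0 * (∫ u, ℓ u ^ (2 * (2 * m)) ∂μ) ^ (1 / 2 : ℝ) := by gcongr
    _ ≤ max C 0 * (a (2 * m) ^ (1 / 2 : ℝ) * (∫ u, ℓ u ^ 2 ∂μ) ^ m) := by gcongr
    _ = _ := by ring

theorem aux_incr {d : ℕ} (μ : Measure (PathSpace d))
    (hmom : ∀ k : ℕ, Integrable (fun u => ‖u‖ ^ k) μ) (i : Fin d) (s t : Set.Icc (0 : ℝ) 1) :
    ∫ u, (auxEval d i t - auxEval d i s) u ^ 2 ∂μ ≤ ∫ u, ‖u t - u s‖ ^ 2 ∂μ := by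
  refine integral_mono (aux_integrable_s2 μ hmom _ 2) ?_ ?_
  · refine ((hmom 2).const_mul 4).mono' ?_ ?_
    · have : Continuous fun u : PathSpace d => ‖u t - u s‖ ^ 2 := by fun_prop
      exact this.measurable.aestronglyMeasurable
    · filter_upwards with u
      have h1 := u.norm_coe_le_norm t
      have h2 := u.norm_coe_le_norm s
      have h3 := norm_sub_le (u t) (u s)
      rw [Real.norm_eq_abs, abs_of_nonneg (by positivity)]
      have : ‖u t - u s‖ ≤ 2 * ‖u‖ := by linarith
      calc _ ≤ (2 * ‖u‖) ^ 2 := by gcongr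
        _ = _ := by ring
  · intro u
    simp only [sub_apply, auxEval_apply]
    have := PiLp.norm_apply_le (u t - u s) i
    rw [PiLp.sub_apply, Real.norm_eq_abs] at this
    calc (u t i - u s i) ^ 2 = |u t i - u s i| ^ 2 := (sq_abs _).symm
      _ ≤ _ := by gcongr

theorem aux_norm_le {d : ℕ} (x : EuclideanSpace ℝ (Fin d)) (b : ℝ) (h : ∀ i, |x i| ≤ b) :
    ‖x‖ ≤ d * b := by
  have hx : x = ∑ i, x i • EuclideanSpace.basisFun (Fin d) ℝ i := by
    have := (EuclideanSpace.basisFun (Fin d) ℝ).sum_repr x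
    simpa using this.symm
  rw [hx]
  refine (norm_sum_le _ _).trans ?_
  calc _ ≤ ∑ i : Fin d, b := by
        refine Finset.sum_le_sum fun i _ => ?_
        rw [norm_smul, (EuclideanSpace.basisFun (Fin d) ℝ).norm_eq_one, mul_one]
        exact h i
    _ = _ := by simp

/-- Dyadic grid point. -/
def auxGrid (n k : ℕ) : Set.Icc (0 : ℝ) 1 := Set.projIcc 0 1 zero_le_one ((k : ℝ) / 2 ^ n)

/-- Dyadic increment functional. -/
def auxDelta (d : ℕ) (i : Fin d) (n k : ℕ) : PathSpace d →L[ℝ] ℝ :=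
  auxEval d i (auxGrid n (k + 1)) - auxEval d i (auxGrid n k)

/-- The chaining functional. -/
def auxF (d m : ℕ) (u : PathSpace d) : ℝ≥0∞ :=
  (∑ i : Fin d, ENNReal.ofReal (auxEval d i 0 u ^ (2 * m))) +
    ∑' n : ℕ, ∑ k ∈ Finset.range (2 ^ n), ∑ i : Fin d,
      ENNReal.ofReal ((3 / 2) ^ n * auxDelta d i n k u ^ (2 * m))

theorem auxGrid_dist (n k : ℕ) :
    |(auxGrid n (k + 1) : ℝ) - (auxGrid n k : ℝ)| ≤ (1 / 2) ^ n := by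
  have h := (LipschitzWith.projIcc (zero_le_one : (0 : ℝ) ≤ 1)).dist_le_mul
    (((k + 1 : ℕ) : ℝ) / 2 ^ n) ((k : ℝ) / 2 ^ n)
  rw [NNReal.coe_one, one_mul, Subtype.dist_eq, Real.dist_eq, Real.dist_eq] at h
  refine h.trans (le_of_eq ?_)
  push_cast
  rw [← sub_div, add_sub_cancel_left, abs_of_nonneg (by positivity)]
  simp

theorem auxF_mem (d m : ℕ) (hm : 1 ≤ m) (M : ℝ≥0∞) (hM : M ≠ ∞) :
    ∃ K : Set (PathSpace d), IsCompact K ∧ ∀ u, auxF d m u ≤ M → u ∈ K := by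
  have hm0 : (2 * m : ℕ) ≠ 0 := by omega
  set A : ℝ := M.toReal ^ ((2 * m : ℕ) : ℝ)⁻¹ with hA
  set r : ℝ := (2 / 3 : ℝ) ^ ((2 * m : ℕ) : ℝ)⁻¹ with hr
  have hA0 : 0 ≤ A := by positivity
  have hr0 : 0 ≤ r := by positivity
  have hAp : A ^ (2 * m) = M.toReal := Real.rpow_inv_natCast_pow ENNReal.toReal_nonneg hm0
  have hrp : r ^ (2 * m) = 2 / 3 := Real.rpow_inv_natCast_pow (by norm_num) hm0
  have hr1 : r < 1 := Real.rpow_lt_one (by norm_num) (by norm_num) (by positivity)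
  have habs : ∀ x b : ℝ, 0 ≤ b → x ^ (2 * m) ≤ b ^ (2 * m) → |x| ≤ b := by
    intro x b hb h
    have hev : Even (2 * m) := even_two_mul m
    rw [← hev.pow_abs x] at h
    exact (pow_le_pow_iff_left₀ (abs_nonneg x) hb hm0).1 h
  refine ⟨_, aux_compact d (d * A) (d * A * (1 + 2 / (1 - r))) r hr0 hr1, ?_⟩
  intro u hu
  have h0 : ∀ i, |u 0 i| ≤ A := by
    intro i
    apply habs _ _ hA0
    rw [hAp, ← ENNReal.ofReal_le_iff_le_toReal hM]
    refine le_trans ?_ hu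
    refine le_trans ?_ (le_self_add)
    exact Finset.single_le_sum (f := fun i : Fin d => ENNReal.ofReal (auxEval d i 0 u ^ (2 * m)))
      (fun _ _ => zero_le) (Finset.mem_univ i)
  have h1 : ∀ n k i, k < 2 ^ n → |auxDelta d i n k u| ≤ A * r ^ n := by
    intro n k i hk
    apply habs _ _ (by positivity)
    rw [mul_pow, hAp, ← pow_mul, mul_comm n, pow_mul r, hrp]
    have : (3 / 2) ^ n * auxDelta d i n k u ^ (2 * m) ≤ M.toReal := by
      rw [← ENNReal.ofReal_le_iff_le_toReal hM]
      refine le_trans ?_ hu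
      refine le_trans ?_ (le_add_self)
      refine le_trans ?_ (ENNReal.le_tsum n)
      refine le_trans ?_ (Finset.single_le_sum (fun _ _ => zero_le) (Finset.mem_range.2 hk))
      exact Finset.single_le_sum (f := fun i : Fin d =>
        ENNReal.ofReal ((3 / 2) ^ n * auxDelta d i n k u ^ (2 * m)))
        (fun _ _ => zero_le) (Finset.mem_univ i)
    calc auxDelta d i n k u ^ (2 * m)
        = ((3 / 2) ^ n * auxDelta d i n k u ^ (2 * m)) * (2 / 3) ^ n := by
          rw [mul_right_comm, ← mul_pow]; norm_num
      _ ≤ _ := by gcongr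
  have h2 : ∀ n k : ℕ, dist (u (auxGrid n k)) (u (auxGrid n (k + 1))) ≤ d * A * r ^ n := by
    intro n k
    by_cases hk : k < 2 ^ n
    · rw [dist_comm, dist_eq_norm, mul_assoc]
      exact aux_norm_le _ _ fun i => h1 n k i hk
    · have hk' : (2 : ℝ) ^ n ≤ k := by exact_mod_cast not_lt.1 hk
      have e1 : auxGrid n k = 1 := Set.projIcc_of_right_le _ ((one_le_div (by positivity)).2 hk')
      have e2 : auxGrid n (k + 1) = 1 := Set.projIcc_of_right_le _
        ((one_le_div (by positivity)).2 (by push_cast; linarith))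
      rw [e1, e2, dist_self]
      positivity
  refine ⟨aux_norm_le _ _ h0, ?_⟩
  have hfc : Continuous (fun x : ℝ => u (Set.projIcc 0 1 zero_le_one x)) :=
    u.continuous.comp continuous_projIcc
  have main : ∀ (n : ℕ) (s t : Set.Icc (0 : ℝ) 1), s ≤ t →
      dist s t ≤ (1 / 2) ^ n → dist (u s) (u t) ≤ d * A * (1 + 2 / (1 - r)) * r ^ n := by
    intro n s t hst hd
    have := aux_chain _ hfc (d * A) r (by positivity) hr0 hr1 h2 n s t s.2.1 hst (by
      rw [dist_comm, Subtype.dist_eq, Real.dist_eq] at hd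
      exact (le_abs_self _).trans hd)
    simpa using this
  intro n s t hd
  rcases le_total s t with h | h
  · exact main n s t h hd
  · rw [dist_comm] at hd ⊢
    exact main n t s h hd

theorem auxF_lintegral {d m : ℕ} (ν : Measure (PathSpace d))
    (hmom : ∀ k : ℕ, Integrable (fun u => ‖u‖ ^ k) ν) (D : ℝ) (E : Fin d → ℝ)
    (hE : ∀ i, ∫ u, auxEval d i 0 u ^ (2 * m) ∂ν ≤ E i)
    (hD : ∀ i n k, ∫ u, auxDelta d i n k u ^ (2 * m) ∂ν ≤ D * (1 / 4) ^ n) :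
    ∫⁻ u, auxF d m u ∂ν ≤ (∑ i : Fin d, ENNReal.ofReal (E i)) +
      ∑' n : ℕ, ENNReal.ofReal (d * D * (3 / 4) ^ n) := by
  have hconv : ∀ (ℓ : PathSpace d →L[ℝ] ℝ) (b e : ℝ), 0 ≤ b →
      ∫ u, ℓ u ^ (2 * m) ∂ν ≤ e →
      ∫⁻ u, ENNReal.ofReal (b * ℓ u ^ (2 * m)) ∂ν ≤ ENNReal.ofReal (b * e) := by
    intro ℓ b e hb h
    rw [← ofReal_integral_eq_lintegral_ofReal ((aux_integrable_s2 ν hmom ℓ (2 * m)).const_mul b)]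
    · apply ENNReal.ofReal_le_ofReal
      rw [integral_const_mul]
      gcongr
    · filter_upwards with u
      simp only [Pi.zero_apply, pow_mul]
      positivity
  have hmeas : ∀ (ℓ : PathSpace d →L[ℝ] ℝ) (b : ℝ),
      Measurable fun u => ENNReal.ofReal (b * ℓ u ^ (2 * m)) := by
    intro ℓ b
    have : Continuous fun u => b * ℓ u ^ (2 * m) := by fun_prop
    exact this.measurable.ennreal_ofReal
  have hm2 : ∀ n : ℕ, Measurable fun u => ∑ k ∈ Finset.range (2 ^ n), ∑ i : Fin d,
      ENNReal.ofReal ((3 / 2) ^ n * auxDelta d i n k u ^ (2 * m)) := fun n =>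
    Finset.measurable_fun_sum _ fun k _ => Finset.measurable_fun_sum _ fun i _ => hmeas _ _
  unfold auxF
  rw [lintegral_add_right _ (Measurable.tsum fun n => hm2 n), lintegral_tsum fun n => (hm2 n).aemeasurable]
  have hm1 : ∀ i : Fin d, Measurable fun u => ENNReal.ofReal (auxEval d i 0 u ^ (2 * m)) := by
    intro i
    simpa using hmeas (auxEval d i 0) 1
  refine add_le_add ?_ (ENNReal.tsum_le_tsum fun n => ?_)
  · rw [lintegral_finsetSum _ fun i _ => hm1 i]
    refine Finset.sum_le_sum fun i _ => ?_
    simpa using hconv (auxEval d i 0) 1 _ zero_le_one (hE i)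
  · rw [lintegral_finsetSum _ fun k _ => Finset.measurable_fun_sum _ fun i _ => hmeas _ _]
    calc _ ≤ ∑ k ∈ Finset.range (2 ^ n), ∑ i : Fin d,
          ENNReal.ofReal ((3 / 2) ^ n * (D * (1 / 4) ^ n)) := by
          refine Finset.sum_le_sum fun k _ => ?_
          rw [lintegral_finsetSum _ fun i _ => hmeas _ _]
          exact Finset.sum_le_sum fun i _ => hconv _ _ _ (by positivity) (hD i n k)
      _ = ENNReal.ofReal (d * D * (3 / 4) ^ n) := by
          rw [Finset.sum_const, Finset.sum_const, smul_smul, ← ENNReal.ofReal_nsmul, Finset.card_univ,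
            Fintype.card_fin, Finset.card_range, nsmul_eq_mul]
          congr 1
          push_cast
          rw [show (3 / 4 : ℝ) = 2 * (3 / 2) * (1 / 4) by norm_num, mul_pow, mul_pow]
          ring

theorem auxF_measurable (d m : ℕ) : Measurable (auxF d m) := by
  have hmeas : ∀ (ℓ : PathSpace d →L[ℝ] ℝ) (b : ℝ),
      Measurable fun u => ENNReal.ofReal (b * ℓ u ^ (2 * m)) := by
    intro ℓ b
    have : Continuous fun u => b * ℓ u ^ (2 * m) := by fun_prop
    exact this.measurable.ennreal_ofReal
  unfold auxF
  refine Measurable.add (Finset.measurable_fun_sum _ fun i _ => ?_)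
    (Measurable.tsum fun n => Finset.measurable_fun_sum _ fun k _ =>
      Finset.measurable_fun_sum _ fun i _ => hmeas _ _)
  simpa using hmeas (auxEval d i 0) 1

/-- a family of probability measures on `C([0,1],ℝ^d)` which is uniformly
finitely absolutely continuous with respect to a fixed centered, polynomially
non-degenerate measure `μ` with Hölder-type second moments of increments is relatively
compact in the topology of weak convergence. -/
theorem weak_compactness_of_uniform_finAbsCont_pathSpace
    (d : ℕ) (μ : Measure (PathSpace d)) [IsProbabilityMeasure μ]
    -- μ has all moments of the (supremum) norm
    (hmom : ∀ k : ℕ, Integrable (fun u => ‖u‖ ^ k) μ)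
    -- μ is centered
    (hcen : ∀ ℓ : PathSpace d →L[ℝ] ℝ, ∫ u, ℓ u ∂μ = 0)
    -- moment comparison (consequence of polynomial non-degeneracy of μ)
    (a : ℕ → ℝ) (ha : ∀ m : ℕ, 1 ≤ m → 0 < a m)
    (hcmp : ∀ (m : ℕ), 1 ≤ m → ∀ φ : PathSpace d →L[ℝ] ℝ,
      ∫ u, φ u ^ (2 * m) ∂μ ≤ a m * (∫ u, φ u ^ 2 ∂μ) ^ m)
    -- Hölder bound on second moments of increments
    (c γ : ℝ) (hc : 0 < c) (hγ : 0 < γ)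
    (hinc : ∀ t₁ t₂ : Set.Icc (0 : ℝ) 1,
      ∫ u, ‖u t₂ - u t₁‖ ^ 2 ∂μ ≤ c * |(t₂ : ℝ) - (t₁ : ℝ)| ^ γ)
    {Θ : Type*} (μα : Θ → ProbabilityMeasure (PathSpace d))
    (hαmom : ∀ (α : Θ) (k : ℕ), Integrable (fun u => ‖u‖ ^ k) (μα α : Measure (PathSpace d)))
    (cα : Θ → ℕ → ℝ)
    (hfac : ∀ α : Θ, FinAbsCont (μα α : Measure (PathSpace d)) μ (cα α))
    (hsup : ∀ n : ℕ, BddAbove (Set.range fun α => cα α n)) :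
    IsCompact (closure (Set.range μα)) := by
  apply isCompact_closure_of_isTightMeasureSet
  obtain ⟨m, hm⟩ := exists_nat_gt (max 1 (2 / γ))
  have hm1 : 1 ≤ m := by exact_mod_cast ((le_max_left _ _).trans hm.le)
  have hmγ : 2 ≤ γ * m := by
    have := (le_max_right _ _).trans hm.le
    rwa [div_le_iff₀ hγ, mul_comm] at this
  obtain ⟨C, hC0, hC⟩ := aux_moment_s2 μ a ha hcmp μα cα hfac hsup m hm1
  set D : ℝ := C * c ^ m with hD
  have hD0 : 0 ≤ D := by positivity
  set E : Fin d → ℝ := fun i => C * (∫ u, auxEval d i 0 u ^ 2 ∂μ) ^ m with hE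
  set T : ℝ≥0∞ := (∑ i : Fin d, ENNReal.ofReal (E i)) +
      ∑' n : ℕ, ENNReal.ofReal (d * D * (3 / 4) ^ n) with hT
  have hTfin : T ≠ ∞ := by
    refine ENNReal.add_ne_top.2 ⟨?_, ?_⟩
    · exact ENNReal.sum_ne_top.2 fun i _ => ENNReal.ofReal_ne_top
    · exact ((summable_geometric_of_lt_one (by norm_num) (by norm_num)).mul_left _).tsum_ofReal_ne_top
  have hbound : ∀ α, ∫⁻ u, auxF d m u ∂(μα α : Measure (PathSpace d)) ≤ T := by
    intro α
    refine auxF_lintegral _ (hαmom α) D E (fun i => hC α _) ?_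
    intro i n k
    refine (hC α _).trans ?_
    have hq := aux_incr μ hmom i (auxGrid n k) (auxGrid n (k + 1))
    have hq2 := hq.trans (hinc _ _)
    have hq3 : |(auxGrid n (k + 1) : ℝ) - (auxGrid n k : ℝ)| ^ γ ≤ ((1 / 2 : ℝ) ^ n) ^ γ :=
      Real.rpow_le_rpow (abs_nonneg _) (auxGrid_dist n k) hγ.le
    have hV : ∫ u, auxDelta d i n k u ^ 2 ∂μ ≤ c * ((1 / 2 : ℝ) ^ n) ^ γ :=
      hq2.trans (by gcongr)
    have hV0 : 0 ≤ ∫ u, auxDelta d i n k u ^ 2 ∂μ := integral_nonneg fun u => by positivity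
    have h4 : (((1 / 2 : ℝ) ^ n) ^ γ) ^ m ≤ (1 / 4) ^ n := by
      rw [← Real.rpow_natCast, ← Real.rpow_mul (by positivity)]
      calc _ ≤ ((1 / 2 : ℝ) ^ n) ^ (2 : ℝ) :=
            Real.rpow_le_rpow_of_exponent_ge (by positivity)
              (pow_le_one₀ (by norm_num) (by norm_num)) hmγ
        _ = _ := by
            rw [Real.rpow_two, ← pow_mul, mul_comm n 2, pow_mul]; norm_num
    calc C * (∫ u, auxDelta d i n k u ^ 2 ∂μ) ^ m
        ≤ C * (c * ((1 / 2 : ℝ) ^ n) ^ γ) ^ m := by gcongr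
      _ = D * (((1 / 2 : ℝ) ^ n) ^ γ) ^ m := by rw [mul_pow, hD]; ring
      _ ≤ _ := by gcongr
  rw [isTightMeasureSet_iff_exists_isCompact_measure_compl_le]
  intro ε hε
  rcases eq_or_ne ε ∞ with rfl | hεt
  · exact ⟨∅, isCompact_empty, fun _ _ => le_top⟩
  have hM : T / ε + 1 ≠ ∞ :=
    ENNReal.add_ne_top.2 ⟨ENNReal.div_ne_top hTfin hε.ne', ENNReal.one_ne_top⟩
  obtain ⟨K, hK, hKm⟩ := auxF_mem d m hm1 _ hM
  refine ⟨K, hK, ?_⟩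
  rintro _ ⟨_, ⟨α, rfl⟩, rfl⟩
  calc (μα α : Measure (PathSpace d)) Kᶜ
      ≤ (μα α : Measure (PathSpace d)) {u | T / ε + 1 ≤ auxF d m u} := by
        apply measure_mono
        intro u hu
        by_contra hcon
        exact hu (hKm u (not_le.1 hcon).le)
    _ ≤ T / (T / ε + 1) :=
        ENNReal.le_div_iff_mul_le (by simp) (by simp [hM]) |>.2 (by
          rw [mul_comm]
          exact (mul_meas_ge_le_lintegral₀ (auxF_measurable d m).aemeasurable _).trans (hbound α))
    _ ≤ ε := by
        apply ENNReal.div_le_of_le_mul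
        rw [mul_add, ENNReal.mul_div_cancel hε.ne' hεt]
        exact le_self_add
end
end

section
/- Let ν and μ be Gaussian Borel probability measures on a real separable Hilbert space H having the same covariance operator S, with mean value 0 for ν and mean value h ∈ H for μ. If ν is finitely absolutely continuous with respect to μ, then ν is absolutely continuous with respect to μ. -/
open MeasureTheory ProbabilityTheory Real Filter
open scoped NNReal ENNReal RealInnerProductSpace

noncomputable section

section helpers

lemma aux_lipschitz {Ω : Type*} [MeasurableSpace Ω] (ν : Measure Ω) [IsProbabilityMeasure ν]
    (f g : Lp ℝ 2 ν) :
    ‖(∫ x, Complex.exp (f x * Complex.I) ∂ν) - ∫ x, Complex.exp (g x * Complex.I) ∂ν‖ ≤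
      ‖f - g‖ := by
  have hint : ∀ f : Lp ℝ 2 ν, Integrable (fun x => Complex.exp (f x * Complex.I)) ν := by
    intro f
    refine Integrable.of_bound (C := 1) ?_ ?_
    · have := (Lp.aestronglyMeasurable f).aemeasurable
      exact AEMeasurable.aestronglyMeasurable (by fun_prop)
    · exact ae_of_all _ fun x => by rw [Complex.norm_exp_ofReal_mul_I]
  rw [← integral_sub (hint f) (hint g)]
  have h1 : Integrable (fun x => (f - g) x) ν := (Lp.memLp (f - g)).integrable (by norm_num)
  calc _ ≤ ∫ x, ‖(f - g) x‖ ∂ν := by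
        refine norm_integral_le_of_norm_le h1.norm ?_
        filter_upwards [Lp.coeFn_sub f g] with x hx
        rw [hx, Pi.sub_apply]
        have e : Complex.exp (f x * Complex.I) - Complex.exp (g x * Complex.I) =
            Complex.exp (g x * Complex.I) *
              (Complex.exp (Complex.I * ((f x - g x : ℝ) : ℂ)) - 1) := by
          rw [mul_sub, ← Complex.exp_add]; push_cast; ring_nf
        rw [e, norm_mul, Complex.norm_exp_ofReal_mul_I, one_mul]
        exact Real.norm_exp_I_mul_ofReal_sub_one_le
    _ ≤ ‖f - g‖ := by
        rw [integral_norm_eq_lintegral_enorm h1.aestronglyMeasurable, Lp.norm_def,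
          ← eLpNorm_one_eq_lintegral_enorm]
        exact ENNReal.toReal_mono (Lp.eLpNorm_ne_top _)
          (eLpNorm_le_eLpNorm_of_exponent_le (by norm_num) h1.aestronglyMeasurable)

/-- elements of the closure of a space of centred Gaussians are centred Gaussian. -/
lemma aux_closure {Ω : Type*} [MeasurableSpace Ω] (ν : Measure Ω) [IsProbabilityMeasure ν]
    (V : Submodule ℝ (Lp ℝ 2 ν))
    (hV : ∀ f ∈ V, ν.map f = gaussianReal 0 (‖f‖₊ ^ 2))
    (f : Lp ℝ 2 ν) (hf : f ∈ V.topologicalClosure) :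
    ν.map f = gaussianReal 0 (‖f‖₊ ^ 2) := by
  have hm : ∀ f : Lp ℝ 2 ν, AEMeasurable f ν := fun f => (Lp.aestronglyMeasurable f).aemeasurable
  have hcont : Continuous fun f : Lp ℝ 2 ν => ∫ x, Complex.exp (f x * Complex.I) ∂ν := by
    refine LipschitzWith.continuous (K := 1) (LipschitzWith.of_dist_le_mul fun f g => ?_)
    rw [dist_eq_norm, dist_eq_norm]
    simpa using aux_lipschitz ν f g
  have hchar : ∀ (f : Lp ℝ 2 ν) (t : ℝ), charFun (ν.map f) t =
      ∫ x, Complex.exp ((t • f : Lp ℝ 2 ν) x * Complex.I) ∂ν := by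
    intro f t
    rw [charFun_apply_real, integral_map (hm f) (by fun_prop)]
    refine integral_congr_ae ?_
    filter_upwards [Lp.coeFn_smul t f] with x hx
    rw [hx]; simp
  have key : ∀ f ∈ V.topologicalClosure, ∫ x, Complex.exp (f x * Complex.I) ∂ν =
      Complex.exp (-((‖f‖ ^ 2 / 2 : ℝ) : ℂ)) := by
    have hclosed : IsClosed {f : Lp ℝ 2 ν | ∫ x, Complex.exp (f x * Complex.I) ∂ν =
      Complex.exp (-((‖f‖ ^ 2 / 2 : ℝ) : ℂ))} :=
      isClosed_eq hcont (by fun_prop)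
    intro f hf
    refine hclosed.closure_subset_iff.2 ?_ (show f ∈ closure (V : Set (Lp ℝ 2 ν)) from hf)
    intro g hg
    have := hchar g 1
    rw [hV g hg, charFun_gaussianReal, one_smul] at this
    rw [Set.mem_ofPred_eq, ← this]
    congr 1
    push_cast
    ring
  have : IsProbabilityMeasure (ν.map f) := Measure.isProbabilityMeasure_map (hm f)
  refine Measure.ext_of_charFun (funext fun t => ?_)
  rw [hchar, key _ (Submodule.smul_mem _ _ hf), charFun_gaussianReal]
  congr 1
  rw [norm_smul, mul_pow, Real.norm_eq_abs, sq_abs]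
  push_cast
  simp
  ring

lemma aux_exp {Ω : Type*} [MeasurableSpace Ω] (ν : Measure Ω)
    (f : Ω → ℝ) (v : ℝ≥0) (hf : ν.map f = gaussianReal 0 v) :
    ∫ x, Real.exp (f x) ∂ν = Real.exp (v / 2) := by
  have := mgf_gaussianReal hf 1
  simpa [mgf] using this

lemma aux_exp_int {Ω : Type*} [MeasurableSpace Ω] (ν : Measure Ω)
    (f : Ω → ℝ) (v : ℝ≥0) (hf : ν.map f = gaussianReal 0 v) :
    Integrable (fun x => Real.exp (f x)) ν := by
  by_contra h
  have := aux_exp ν f v hf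
  rw [integral_undef h] at this
  exact (Real.exp_pos _).ne this

lemma aux_map_eq {Ω : Type*} [MeasurableSpace Ω] (ρ : Measure Ω) [IsProbabilityMeasure ρ]
    (X : Ω → ℝ) (hX : AEMeasurable X ρ) (m : ℝ) (v : ℝ≥0)
    (h : ∀ t, mgf X ρ t = Real.exp (m * t + v * t ^ 2 / 2)) : ρ.map X = gaussianReal m v := by
  have h1 : mgf id (gaussianReal m v) = mgf X ρ := by
    rw [mgf_id_gaussianReal]; funext t; exact (h t).symm
  have h2 := eqOn_complexMGF_of_mgf h1
  simp only [integrableExpSet_id_gaussianReal, interior_univ, Set.mem_univ, Set.ofPred_true] at h2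
  have h3 := Measure.ext_of_complexMGF_eq aemeasurable_id hX (funext fun z => h2 (Set.mem_univ z))
  rw [← h3, Measure.map_id]

end helpers

/-- if `ν` and `μ` are Gaussian measures on a separable Hilbert space
with the same covariance operator, respective means `0` and `h`, and `ν` is finitely
absolutely continuous with respect to `μ`, then `ν ≪ μ`. -/
theorem gaussian_finAbsCont_implies_absCont
    {H : Type*} [NormedAddCommGroup H] [InnerProductSpace ℝ H] [CompleteSpace H]
    [TopologicalSpace.SeparableSpace H] [MeasurableSpace H] [BorelSpace H]
    (ν μ : Measure H) [IsProbabilityMeasure ν] [IsProbabilityMeasure μ] (h : H)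
    -- ν is a Gaussian measure with mean 0
    (hνgauss : ∀ ℓ : H →L[ℝ] ℝ, ∃ v : ℝ≥0, ν.map ℓ = gaussianReal 0 v)
    -- μ is a Gaussian measure with mean h
    (hμgauss : ∀ ℓ : H →L[ℝ] ℝ, ∃ v : ℝ≥0, μ.map ℓ = gaussianReal (ℓ h) v)
    -- ν and μ have the same covariance operator
    (hcov : ∀ g g' : H,
      ∫ u, ⟪g, u⟫ * ⟪g', u⟫ ∂ν = ∫ u, ⟪g, u - h⟫ * ⟪g', u - h⟫ ∂μ)
    -- ν is finitely absolutely continuous with respect to μ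
    (c : ℕ → ℝ) (hcpos : ∀ n, 0 < c n) (hfac : FinAbsCont ν μ c) :
    ν ≪ μ := by
  have hνG : IsGaussian ν := isGaussian_of_map_eq_gaussianReal fun L => ⟨0, hνgauss L⟩
  have hμG : IsGaussian μ := isGaussian_of_map_eq_gaussianReal fun L => ⟨L h, hμgauss L⟩
  have hL2 : MemLp id 2 ν := IsGaussian.memLp_two_id
  have hL2' : ∀ ℓ : StrongDual ℝ H, MemLp ℓ 2 ν := fun ℓ => hL2.continuousLinearMap_comp ℓ
  let T : StrongDual ℝ H →ₗ[ℝ] Lp ℝ 2 ν := StrongDual.toLpₗ ν 2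
  have hT : ∀ ℓ, T ℓ =ᵐ[ν] ℓ := by
    intro ℓ
    have : T ℓ = MemLp.toLp ℓ (hL2' ℓ) := StrongDual.toLpₗ_apply hL2 ℓ
    rw [this]
    exact MemLp.coeFn_toLp _
  -- norms
  have hTn : ∀ ℓ, ‖T ℓ‖ ^ 2 = ∫ x, ℓ x ^ 2 ∂ν := by
    intro ℓ
    rw [← real_inner_self_eq_norm_sq, L2.inner_def]
    refine integral_congr_ae ?_
    filter_upwards [hT ℓ] with x hx
    rw [hx]; simp [sq]
  have hνmap : ∀ ℓ : StrongDual ℝ H, ν.map ℓ = gaussianReal 0 (‖T ℓ‖₊ ^ 2) := by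
    intro ℓ
    obtain ⟨v, hv⟩ := hνgauss ℓ
    have h1 : ∫ x, ℓ x ^ 2 ∂ν = v := by
      have := variance_id_gaussianReal (μ := 0) (v := v)
      rw [variance_eq_integral (by fun_prop)] at this
      simp only [id_eq, integral_id_gaussianReal, sub_zero] at this
      rw [← hv, integral_map (by fun_prop) (by fun_prop)] at this
      exact this
    rw [hv]
    congr 1
    apply NNReal.eq
    push_cast
    rw [hTn, h1]
  have hμvar : ∀ ℓ : StrongDual ℝ H, ∫ x, (ℓ x - ℓ h) ^ 2 ∂μ = ‖T ℓ‖ ^ 2 := by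
    intro ℓ
    have := hcov ((InnerProductSpace.toDual ℝ H).symm ℓ) ((InnerProductSpace.toDual ℝ H).symm ℓ)
    simp only [InnerProductSpace.toDual_symm_apply, map_sub] at this
    rw [hTn]
    simp only [sq]
    exact this.symm
  have hμmap : ∀ ℓ : StrongDual ℝ H, μ.map ℓ = gaussianReal (ℓ h) (‖T ℓ‖₊ ^ 2) := by
    intro ℓ
    obtain ⟨v, hv⟩ := hμgauss ℓ
    have h1 : ∫ x, (ℓ x - ℓ h) ^ 2 ∂μ = v := by
      have := variance_id_gaussianReal (μ := ℓ h) (v := v)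
      rw [variance_eq_integral (by fun_prop)] at this
      simp only [id_eq, integral_id_gaussianReal] at this
      rw [← hv, integral_map (by fun_prop) (by fun_prop)] at this
      exact this
    rw [hv]
    congr 1
    apply NNReal.eq
    push_cast
    rw [← hμvar, h1]
  -- the Cameron-Martin bound
  have hbound : ∀ ℓ : StrongDual ℝ H, |ℓ h| ≤ c 1 * ‖T ℓ‖ := by
    intro ℓ
    have := hfac 1 (MvPolynomial.X 0 - MvPolynomial.C (ℓ h)) (by
      refine (MvPolynomial.totalDegree_sub _ _).trans ?_
      simp) (fun _ => ℓ)
    simp only [map_sub, MvPolynomial.eval_X, MvPolynomial.eval_C] at this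
    rw [hμvar, integral_sub (IsGaussian.integrable_dual ν ℓ) (integrable_const _)] at this
    have h0 : ∫ x, ℓ x ∂ν = 0 := by
      obtain ⟨v, hv⟩ := hνgauss ℓ
      have := integral_id_gaussianReal (μ := 0) (v := v)
      rwa [← hv, integral_map (by fun_prop) (by fun_prop)] at this
    rw [h0, ← Real.sqrt_eq_rpow, Real.sqrt_sq (norm_nonneg _)] at this
    simpa using this
  let V : Submodule ℝ (Lp ℝ 2 ν) := LinearMap.range T
  have hclos : ∀ f ∈ V.topologicalClosure, ν.map f = gaussianReal 0 (‖f‖₊ ^ 2) := by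
    refine fun f hf => aux_closure ν V ?_ f hf
    rintro _ ⟨ℓ, rfl⟩
    rw [← hνmap ℓ, Measure.map_congr (hT ℓ)]
  -- Riesz representation
  obtain ⟨k, hkV, hk⟩ : ∃ k ∈ V.topologicalClosure, ∀ ℓ, ⟪k, T ℓ⟫ = ℓ h := by
    let W := V.topologicalClosure
    have : CompleteSpace W := V.isClosed_topologicalClosure.completeSpace_coe
    let e : StrongDual ℝ H →ₗ[ℝ] W :=
      T.codRestrict W fun ℓ => V.le_topologicalClosure ⟨ℓ, rfl⟩
    have he : DenseRange e := by
      intro w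
      rw [closure_subtype]
      refine closure_mono ?_ (show (w : Lp ℝ 2 ν) ∈ closure (V : Set (Lp ℝ 2 ν)) from w.2)
      rintro _ ⟨ℓ, rfl⟩
      exact ⟨e ℓ, ⟨ℓ, rfl⟩, rfl⟩
    let ev : StrongDual ℝ H →ₗ[ℝ] ℝ := (ContinuousLinearMap.apply ℝ ℝ h).toLinearMap
    let F : W →L[ℝ] ℝ := ev.extendOfNorm e
    have hF : ∀ ℓ, F (e ℓ) = ℓ h := fun ℓ =>
      LinearMap.extendOfNorm_eq he ⟨c 1, fun ℓ => hbound ℓ⟩ ℓ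
    refine ⟨((InnerProductSpace.toDual ℝ W).symm F : W), Subtype.property _, fun ℓ => ?_⟩
    rw [← hF ℓ, ← InnerProductSpace.toDual_symm_apply (𝕜 := ℝ) (x := e ℓ) (y := F)]
    rfl
  have hkint : Integrable (fun x => Real.exp (k x)) ν := aux_exp_int ν k _ (hclos k hkV)
  have hprob : IsProbabilityMeasure (ν.tilted k) := isProbabilityMeasure_tilted hkint
  suffices hμ : μ = ν.tilted k by
    rw [hμ]; exact absolutelyContinuous_tilted hkint
  refine Measure.ext_of_charFunDual (funext fun ℓ => ?_)
  rw [charFunDual_eq_charFun_map_one, charFunDual_eq_charFun_map_one, hμmap ℓ]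
  rw [aux_map_eq (ν.tilted k) ℓ (by fun_prop) (ℓ h) (‖T ℓ‖₊ ^ 2)]
  intro t
  have hmem : k + t • T ℓ ∈ V.topologicalClosure :=
    Submodule.add_mem _ hkV (Submodule.smul_mem _ _ (V.le_topologicalClosure ⟨ℓ, rfl⟩))
  have h1 := aux_exp ν _ _ (hclos _ hmem)
  have h2 := aux_exp ν _ _ (hclos _ hkV)
  have h3 : ∫ x, Real.exp ((k + t • T ℓ : Lp ℝ 2 ν) x) ∂ν =
      ∫ x, Real.exp (k x) * Real.exp (t * ℓ x) ∂ν := by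
    refine integral_congr_ae ?_
    filter_upwards [Lp.coeFn_add k (t • T ℓ), Lp.coeFn_smul t (T ℓ), hT ℓ] with x hx hx' hx''
    rw [hx, Pi.add_apply, hx', Pi.smul_apply, hx'', smul_eq_mul, Real.exp_add]
  rw [mgf, integral_tilted]
  simp only [smul_eq_mul, div_mul_eq_mul_div]
  rw [integral_div, ← h3, h1, h2, ← Real.exp_sub]
  congr 1
  push_cast
  rw [norm_add_sq_real, inner_smul_right, hk, norm_smul, mul_pow, Real.norm_eq_abs, sq_abs]
  ring
end
end

section
/- Let ξ(t), t ∈ [0,1], be a centered real-valued Gaussian process with continuous sample paths such that σ²(t) := E ξ(t)² > 0 for every t ∈ [0,1], and there exist c > 0, γ > 0 with E|ξ(t₂) − ξ(t₁)|² ≤ c|t₂ − t₁|^γ for all t₁, t₂ ∈ [0,1]. For ε > 0 define Φ_ε on C([0,1],ℝ) by Φ_ε(f) = ∫₀¹ p_ε(f(t)) dt, where p_ε(x) = (2πε)^{-1/2} exp(−x²/(2ε)). Then for every n ∈ ℕ there exists a constant c_n > 0, independent of ε, such that for every ε > 0, every polynomial P : ℝⁿ → ℝ of degree at most n and all ℓ₁,…,ℓ_n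 ∈ (C([0,1],ℝ))*, |E[Φ_ε(ξ) · P(ℓ₁(ξ),…,ℓ_n(ξ))]| ≤ c_n (E[P(ℓ₁(ξ),…,ℓ_n(ξ))²])^{1/2}. In other words, the measures Φ_ε μ (μ being the law of ξ on C([0,1],ℝ)) are uniformly finitely absolutely continuous with respect to μ. -/
open MeasureTheory ProbabilityTheory Real Filter
open scoped NNReal ENNReal

noncomputable section

attribute [local instance] MeasureTheory.Measure.Subtype.measureSpace

instance : MeasurableSpace C(Set.Icc (0 : ℝ) 1, ℝ) := borel _
instance : BorelSpace C(Set.Icc (0 : ℝ) 1, ℝ) := ⟨rfl⟩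

/-- The centered Gaussian density on `ℝ` with variance `ε`. -/
def gaussDens1 (ε x : ℝ) : ℝ := (Real.sqrt (2 * π * ε))⁻¹ * Real.exp (-x ^ 2 / (2 * ε))

/-- The functional `Φ_ε(f) = ∫₀¹ p_ε(f(t)) dt` on `C([0,1],ℝ)`. -/
def PhiEps (ε : ℝ) (f : C(Set.Icc (0 : ℝ) 1, ℝ)) : ℝ :=
  ∫ t : Set.Icc (0 : ℝ) 1, gaussDens1 ε (f t)

/-- all finite moments -/
def AllLp {Ω : Type*} [MeasurableSpace Ω] (f : Ω → ℝ) (μ : Measure Ω) : Prop :=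
  ∀ p : ℝ≥0, MemLp f p μ

lemma AllLp.mul {Ω : Type*} [MeasurableSpace Ω] {μ : Measure Ω} {f g : Ω → ℝ}
    (hf : AllLp f μ) (hg : AllLp g μ) : AllLp (fun x => f x * g x) μ := by
  intro p
  have : ENNReal.HolderTriple ((2 * p : ℝ≥0) : ℝ≥0∞) ((2 * p : ℝ≥0) : ℝ≥0∞) (p : ℝ≥0∞) := by
    constructor
    push_cast
    rw [ENNReal.mul_inv (by simp) (by simp), ← add_mul, ENNReal.inv_two_add_inv_two, one_mul]
  exact (hg (2 * p)).mul (hf (2 * p))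

lemma AllLp.eval {Ω : Type*} [MeasurableSpace Ω] {μ : Measure Ω} [IsFiniteMeasure μ] {n : ℕ}
    {f : Fin n → Ω → ℝ} (hf : ∀ i, AllLp (f i) μ) (P : MvPolynomial (Fin n) ℝ) :
    AllLp (fun x => MvPolynomial.eval (fun i => f i x) P) μ := by
  induction P using MvPolynomial.induction_on with
  | C a => intro p; simpa using memLp_const a
  | add p q hp hq =>
    intro r
    simp only [map_add]
    exact (hp r).add (hq r)
  | mul_X p i hp => simpa using hp.mul (hf i)

lemma AllLp.polyEval {Ω : Type*} [MeasurableSpace Ω] {μ : Measure Ω} [IsFiniteMeasure μ]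
    {f : Ω → ℝ} (hf : AllLp f μ) (P : Polynomial ℝ) :
    AllLp (fun x => P.eval (f x)) μ := by
  induction P using Polynomial.induction_on with
  | C a => intro p; simpa using memLp_const a
  | add p q hp hq =>
    intro r
    simp only [Polynomial.eval_add]
    exact (hp r).add (hq r)
  | monomial n a h => simpa [pow_succ, mul_assoc] using h.mul hf

lemma allLp_id (v : ℝ≥0) : AllLp (fun x : ℝ => x) (gaussianReal 0 v) :=
  fun p => memLp_id_gaussianReal p

lemma pow_mul_exp_le (i : ℕ) (x : ℝ) : |x| ^ i * exp (-x ^ 2 / 2) ≤ i.factorial * exp 1 := by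
  have h1 : |x| ^ i ≤ i.factorial * exp |x| := by
    have := Real.pow_div_factorial_le_exp |x| (abs_nonneg x) i
    rwa [div_le_iff₀' (by positivity)] at this
  calc |x| ^ i * exp (-x ^ 2 / 2) ≤ i.factorial * exp |x| * exp (-x ^ 2 / 2) := by gcongr
    _ = i.factorial * exp (|x| + -x ^ 2 / 2) := by rw [mul_assoc, Real.exp_add]
    _ ≤ _ := by
      gcongr
      nlinarith [sq_abs x, sq_nonneg (|x| - 1)]

lemma poly_bound_std (n : ℕ) : ∃ K : ℝ, 0 < K ∧ ∀ q : Polynomial ℝ, q.natDegree ≤ n → ∀ x : ℝ,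
    |q.eval x| * exp (-x ^ 2 / 2) ≤ K * √(∫ y, (q.eval y) ^ 2 ∂(gaussianReal 0 1)) := by
  have hm : ∀ q : Polynomial ℝ, MemLp (fun x => q.eval x) 2 (gaussianReal 0 1) := fun q => by
    simpa using (allLp_id 1).polyEval q 2
  let T : Polynomial.degreeLT ℝ (n + 1) →ₗ[ℝ] Lp ℝ 2 (gaussianReal 0 1) :=
    { toFun := fun q => (hm q.1).toLp
      map_add' := fun p q => by
        rw [← MemLp.toLp_add]; congr 1; ext; simp
      map_smul' := fun r q => by
        simp only [RingHom.id_apply]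
        rw [← MemLp.toLp_const_smul]; congr 1; ext; simp }
  let e := Polynomial.degreeLTEquiv ℝ (n + 1)
  let S := T ∘ₗ e.symm.toLinearMap
  have hS : LinearMap.ker S = ⊥ := by
    rw [LinearMap.ker_eq_bot']
    intro m h
    have h2 : (fun x => (e.symm m).1.eval x) =ᵐ[gaussianReal 0 1] 0 := by
      have h3 : (hm (e.symm m).1).toLp = 0 := h
      rw [← MemLp.toLp_zero (MemLp.zero (p := 2) (μ := gaussianReal 0 1) (ε := ℝ))] at h3
      exact (MemLp.toLp_eq_toLp_iff _ _).1 h3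
    have : NullSingletonClass (gaussianReal 0 1) := nullSingletonClass_gaussianReal one_ne_zero
    have h4 : (e.symm m).1 = 0 := by
      by_contra hne
      have hfin : Set.Finite {x | (e.symm m).1.eval x = 0} := by
        exact Polynomial.finite_setOfPred_isRoot hne
      have h5 : gaussianReal 0 1 {x | (e.symm m).1.eval x = 0} = 0 := hfin.measure_zero _
      have h6 : ∀ᵐ x ∂(gaussianReal 0 1), False := by
        filter_upwards [h2, measure_eq_zero_iff_ae_notMem.1 h5] with x hx hx'
        exact hx' hx
      simp at h6
      exact IsProbabilityMeasure.ne_zero _ h6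
    have h5 : e.symm m = 0 := Subtype.ext h4
    simpa using h5
  obtain ⟨K, hK, hK'⟩ := S.exists_antilipschitzWith hS
  refine ⟨K * ∑ i : Fin (n+1), ((i : ℕ).factorial * exp 1), by positivity, ?_⟩
  intro q hq x
  have hq' : q ∈ Polynomial.degreeLT ℝ (n + 1) := by
    rw [Polynomial.mem_degreeLT]
    exact lt_of_le_of_lt Polynomial.degree_le_natDegree (by exact_mod_cast Nat.lt_succ_of_le hq)
  let m := e ⟨q, hq'⟩
  have hSm : S m = (hm q).toLp := by simp [S, m, T]
  have hnorm : ‖S m‖ = √(∫ y, (q.eval y) ^ 2 ∂(gaussianReal 0 1)) := by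
    rw [hSm, Lp.norm_toLp, (hm q).eLpNorm_eq_integral_rpow_norm (by simp) (by simp)]
    rw [ENNReal.toReal_ofReal (by positivity)]
    simp [Real.sqrt_eq_rpow]
  have hm1 : ‖m‖ ≤ K * ‖S m‖ := by
    have := hK'.le_mul_norm  (map_zero S) m
    simpa using this
  have hcoef : ∀ i : Fin (n+1), |q.coeff i| ≤ ‖m‖ := fun i => by
    have := norm_le_pi_norm m i
    simpa [m, e, Polynomial.degreeLTEquiv] using this
  have : q.eval x = ∑ i : Fin (n+1), q.coeff i * x ^ (i : ℕ) := by
    rw [Polynomial.eval_eq_sum_range' (Nat.lt_succ_of_le hq), Finset.sum_range]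
  rw [← hnorm, this]
  calc _ ≤ (∑ i : Fin (n+1), |q.coeff i| * |x| ^ (i : ℕ)) * exp (-x ^ 2 / 2) := by
        gcongr
        refine (Finset.abs_sum_le_sum_abs _ _).trans (le_of_eq ?_)
        simp [abs_mul]
    _ = ∑ i : Fin (n+1), |q.coeff i| * (|x| ^ (i : ℕ) * exp (-x ^ 2 / 2)) := by
        rw [Finset.sum_mul]; simp [mul_assoc]
    _ ≤ ∑ i : Fin (n+1), (K * ‖S m‖) * ((i : ℕ).factorial * exp 1) := by
        refine Finset.sum_le_sum fun i _ => ?_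
        exact mul_le_mul ((hcoef i).trans hm1) (pow_mul_exp_le i x) (by positivity) (by positivity)
    _ = _ := by rw [← Finset.mul_sum]; ring

lemma poly_bound (n : ℕ) : ∃ K : ℝ, 0 < K ∧ ∀ v : ℝ≥0, v ≠ 0 →
    ∀ q : Polynomial ℝ, q.natDegree ≤ n → ∀ x : ℝ,
    |q.eval x| * exp (-x ^ 2 / (2 * v)) ≤ K * √(∫ y, (q.eval y) ^ 2 ∂(gaussianReal 0 v)) := by
  obtain ⟨K, hK, h⟩ := poly_bound_std n
  refine ⟨K, hK, fun v hv q hq x => ?_⟩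
  have hv0 : (0:ℝ) < v := by positivity
  have hs : √(v:ℝ) ≠ 0 := by positivity
  have hdeg : (q.comp (Polynomial.C √(v:ℝ) * Polynomial.X)).natDegree ≤ n := by
    refine Polynomial.natDegree_comp_le.trans ?_
    calc _ ≤ q.natDegree * 1 := by gcongr; exact (Polynomial.natDegree_C_mul_le _ _).trans Polynomial.natDegree_X_le
      _ ≤ n := by simpa using hq
  have := h _ hdeg (x / √(v:ℝ))
  simp only [Polynomial.eval_comp, Polynomial.eval_mul, Polynomial.eval_C, Polynomial.eval_X] at this
  rw [mul_div_cancel₀ _ hs, div_pow, Real.sq_sqrt hv0.le] at this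
  have hg : gaussianReal 0 v = (gaussianReal 0 1).map (√(v:ℝ) * ·) := by
    rw [gaussianReal_map_const_mul]
    congr 1
    · simp
    · ext; simp [Real.sq_sqrt hv0.le]
  rw [hg, integral_map (by fun_prop) (by
    exact (Continuous.pow q.continuous 2).aestronglyMeasurable)]
  convert this using 3
  field_simp

lemma gaussDens1_eq (ε : ℝ) (hε : 0 < ε) (x : ℝ) :
    gaussDens1 ε x = gaussianPDFReal 0 ε.toNNReal x := by
  simp [gaussDens1, gaussianPDFReal, hε.le]

lemma gauss_poly_bound (n : ℕ) : ∃ K : ℝ, 0 < K ∧ ∀ v : ℝ≥0, v ≠ 0 → ∀ ε : ℝ, 0 < ε →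
    ∀ q : Polynomial ℝ, q.natDegree ≤ n →
    |∫ x, gaussDens1 ε x * q.eval x ∂(gaussianReal 0 v)| ≤
      K / √(v:ℝ) * √(∫ y, (q.eval y) ^ 2 ∂(gaussianReal 0 v)) := by
  obtain ⟨K, hK, h⟩ := poly_bound n
  refine ⟨K / √(2 * π), by positivity, fun v hv ε hε q hq => ?_⟩
  rw [integral_gaussianReal_eq_integral_smul hv]
  set N := √(∫ y, (q.eval y) ^ 2 ∂(gaussianReal 0 v)) with hN
  have hv0 : (0:ℝ) < v := by positivity
  have hε' : ε.toNNReal ≠ 0 := by simpa using hε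
  calc _ ≤ ∫ x, gaussianPDFReal 0 ε.toNNReal x * ((√(2 * π * v))⁻¹ * (K * N)) := by
        rw [← Real.norm_eq_abs]
        apply norm_integral_le_of_norm_le ((integrable_gaussianPDFReal _ _).mul_const _)
        refine ae_of_all _ fun x => ?_
        rw [gaussDens1_eq ε hε, norm_smul, norm_mul, Real.norm_of_nonneg (gaussianPDFReal_nonneg 0 v x),
          Real.norm_of_nonneg (gaussianPDFReal_nonneg 0 _ x), mul_left_comm]
        refine mul_le_mul_of_nonneg_left ?_ (gaussianPDFReal_nonneg _ _ _)
        have := h v hv q hq x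
        rw [gaussianPDFReal, mul_assoc, mul_comm (rexp _)]
        simp only [sub_zero]
        exact mul_le_mul_of_nonneg_left this (by positivity)
    _ = _ := by
        rw [integral_mul_const, integral_gaussianPDFReal_eq_one _ hε', Real.sqrt_mul (by positivity)]
        field_simp

lemma continuous_gaussDens1 (ε : ℝ) : Continuous (gaussDens1 ε) := by
  unfold gaussDens1; fun_prop

lemma gaussDens1_abs_le (ε : ℝ) (hε : 0 < ε) (x : ℝ) :
    ‖gaussDens1 ε x‖ ≤ (√(2 * π * ε))⁻¹ := by
  unfold gaussDens1
  rw [Real.norm_of_nonneg (by positivity)]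
  refine mul_le_of_le_one_right (by positivity) ?_
  rw [Real.exp_le_one_iff]
  exact div_nonpos_of_nonpos_of_nonneg (by nlinarith [sq_nonneg x]) (by positivity)

lemma continuous_mvEval {n : ℕ} (P : MvPolynomial (Fin n) ℝ) :
    Continuous (fun y : Fin n → ℝ => MvPolynomial.eval y P) := MvPolynomial.continuous_eval P

lemma integral_sqrt_le {α : Type*} [MeasurableSpace α] (ν : Measure α) [IsProbabilityMeasure ν]
    (g : α → ℝ) (hg0 : ∀ x, 0 ≤ g x) (hg : Integrable g ν) :
    Integrable (fun x => √(g x)) ν ∧ ∫ x, √(g x) ∂ν ≤ √(∫ x, g x ∂ν) := by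
  have h1 : Integrable (fun x => √(g x)) ν := by
    refine Integrable.mono' (hg.add (integrable_const 1)) 
      (Real.continuous_sqrt.comp_aestronglyMeasurable hg.1) (ae_of_all _ fun x => ?_)
    rw [Real.norm_of_nonneg (Real.sqrt_nonneg _)]
    simp only [Pi.add_apply]
    nlinarith [Real.sq_sqrt (hg0 x), sq_nonneg (√(g x) - 1)]
  refine ⟨h1, ?_⟩
  have := (Real.strictConcaveOn_sqrt.concaveOn).le_map_integral (μ := ν) (f := g)
    Real.continuous_sqrt.continuousOn isClosed_Ici (ae_of_all _ fun x => hg0 x) hg h1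
  simpa [Function.comp_def] using this

lemma pair_bound (n : ℕ) {Ω : Type*} [MeasurableSpace Ω] (Pr : Measure Ω)
    [IsProbabilityMeasure Pr] : ∃ K : ℝ, 0 < K ∧ ∀ v : ℝ≥0, v ≠ 0 → ∀ ε : ℝ, 0 < ε →
    ∀ (X : Ω → ℝ) (L : Ω → Fin n → ℝ), HasGaussianLaw (fun ω => (X ω, L ω)) Pr →
    Pr.map X = gaussianReal 0 v →
    ∀ P : MvPolynomial (Fin n) ℝ, P.totalDegree ≤ n →
    |∫ ω, gaussDens1 ε (X ω) * MvPolynomial.eval (L ω) P ∂Pr| ≤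
      K / √(v:ℝ) * √(∫ ω, (MvPolynomial.eval (L ω) P) ^ 2 ∂Pr) := by
  obtain ⟨K, hK, h⟩ := gauss_poly_bound n
  refine ⟨K, hK, fun v hv ε hε X L hG hX P hP => ?_⟩
  have hXG : HasGaussianLaw X Pr := hG.fst
  have hLi : ∀ i, HasGaussianLaw (fun ω => L ω i) Pr := fun i =>
    hG.snd.map (ContinuousLinearMap.proj i)
  have hXm := hXG.aemeasurable
  have hVar : Var[X; Pr] = v := by
    have : Var[id; Pr.map X] = v := by rw [hX]; simp
    rwa [variance_map (by fun_prop) hXm] at this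
  have hv0 : (v : ℝ) ≠ 0 := by simpa using hv
  let a : Fin n → ℝ := fun i => cov[X, fun ω => L ω i; Pr] / v
  let Y : Ω → Fin n → ℝ := fun ω i => L ω i - a i * X ω
  let M : ℝ × (Fin n → ℝ) →L[ℝ] ℝ × (Fin n → ℝ) :=
    (ContinuousLinearMap.fst ℝ ℝ (Fin n → ℝ)).prod
      (ContinuousLinearMap.pi fun i =>
        (ContinuousLinearMap.proj i).comp (ContinuousLinearMap.snd ℝ ℝ (Fin n → ℝ)) -
          a i • ContinuousLinearMap.fst ℝ ℝ (Fin n → ℝ))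
  have hXY : HasGaussianLaw (fun ω => (X ω, Y ω)) Pr := hG.map M
  have hYm := hXY.snd.aemeasurable
  have hcov : ∀ i, cov[X, fun ω => Y ω i; Pr] = 0 := by
    intro i
    have h1 : cov[X, (fun ω => L ω i) - a i • X; Pr] = 0 := by
      rw [covariance_sub_right hXG.memLp_two (hLi i).memLp_two (hXG.memLp_two.const_smul _),
        covariance_smul_right, covariance_self hXm, hVar]
      simp only [a]
      field_simp
      simp
    exact h1
  have hind : IndepFun X Y Pr := by
    apply hXY.indepFun_of_covariance_strongDual
    intro L₁ L₂
    have e1 : L₁ ∘ X = fun ω => L₁ 1 * X ω := by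
      ext ω
      have := L₁.map_smul (X ω) 1
      simp only [smul_eq_mul, mul_one] at this
      simp [this, mul_comm]
    have e2 : L₂ ∘ Y = fun ω => ∑ i, L₂ (Pi.single i 1) * Y ω i := by
      ext ω
      have := L₂.toLinearMap.pi_apply_eq_sum_univ (Y ω)
      simp only [ContinuousLinearMap.coe_coe, smul_eq_mul] at this
      rw [Function.comp_apply, this]
      refine Finset.sum_congr rfl fun i _ => ?_
      rw [mul_comm]
      congr 2
      ext j
      simp [Pi.single_apply, eq_comm]
    have hYi : ∀ i, HasGaussianLaw (fun ω => Y ω i) Pr := fun i =>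
      hXY.snd.map (ContinuousLinearMap.proj i)
    rw [e1, e2, covariance_fun_sum_right (fun i => (hYi i).memLp_two.const_mul _)
      (hXG.memLp_two.const_mul _)]
    simp [covariance_const_mul_left, covariance_const_mul_right, hcov]
  have hprod : Pr.map (fun ω => (X ω, Y ω)) = (gaussianReal 0 v).prod (Pr.map Y) := by
    rw [← hX]; exact (indepFun_iff_map_prod_eq_prod_map_map hXm hYm).1 hind
  set ν := Pr.map Y with hν
  have : IsProbabilityMeasure ν := Measure.isProbabilityMeasure_map hYm
  let G : ℝ × (Fin n → ℝ) → ℝ := fun z => MvPolynomial.eval (fun i => a i * z.1 + z.2 i) P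
  have hGc : Continuous G := (continuous_mvEval P).comp (by fun_prop)
  have hGL : ∀ ω, MvPolynomial.eval (L ω) P = G (X ω, Y ω) := fun ω => by simp [G, Y]
  have hAll : AllLp (fun ω => MvPolynomial.eval (L ω) P) Pr :=
    AllLp.eval (f := fun i ω => L ω i) (fun i p => (hLi i).memLp (by simp)) P
  have hXYm := hXY.aemeasurable
  have hc2 : Continuous (fun z => G z ^ 2) := hGc.pow 2
  have hc1 : Continuous (fun z => gaussDens1 ε z.1 * G z) :=
    ((continuous_gaussDens1 ε).comp continuous_fst).mul hGc
  have hint2 : Integrable (fun z => G z ^ 2) ((gaussianReal 0 v).prod ν) := by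
    rw [← hprod, integrable_map_measure hc2.aestronglyMeasurable hXYm]
    have := (hAll 2).integrable_sq
    simp only [hGL] at this
    exact this
  have hint1 : Integrable (fun z => gaussDens1 ε z.1 * G z) ((gaussianReal 0 v).prod ν) := by
    have hG1 : Integrable G ((gaussianReal 0 v).prod ν) := by
      rw [← hprod, integrable_map_measure hGc.aestronglyMeasurable hXYm]
      have := (hAll 1)
      simp only [hGL] at this
      exact memLp_one_iff_integrable.1 this
    exact hG1.bdd_mul ((continuous_gaussDens1 ε).comp continuous_fst).aestronglyMeasurable
      (ae_of_all _ fun z => gaussDens1_abs_le ε hε z.1)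
  have E1 : ∫ ω, gaussDens1 ε (X ω) * MvPolynomial.eval (L ω) P ∂Pr =
      ∫ y, ∫ x, gaussDens1 ε x * G (x, y) ∂(gaussianReal 0 v) ∂ν := by
    rw [← integral_prod_symm _ hint1, ← hprod, integral_map hXYm
      hc1.aestronglyMeasurable]
    simp only [hGL]
  have E2 : ∫ ω, (MvPolynomial.eval (L ω) P) ^ 2 ∂Pr =
      ∫ y, ∫ x, (G (x, y)) ^ 2 ∂(gaussianReal 0 v) ∂ν := by
    rw [← integral_prod_symm _ hint2, ← hprod, integral_map hXYm
      hc2.aestronglyMeasurable]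
    simp only [hGL]
  rw [E1, E2]
  obtain ⟨hs1, hs2⟩ := integral_sqrt_le ν (fun y => ∫ x, (G (x, y)) ^ 2 ∂(gaussianReal 0 v))
    (fun y => integral_nonneg fun x => sq_nonneg _) hint2.integral_prod_right
  calc _ ≤ ∫ y, K / √(v:ℝ) * √(∫ x, (G (x, y)) ^ 2 ∂(gaussianReal 0 v)) ∂ν := by
        rw [← Real.norm_eq_abs]
        refine norm_integral_le_of_norm_le (hs1.const_mul _) (ae_of_all _ fun y => ?_)
        let q : Polynomial ℝ := MvPolynomial.aeval
          (fun i => Polynomial.C (a i) * Polynomial.X + Polynomial.C (y i)) P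
        have hq : ∀ x, q.eval x = G (x, y) := by
          intro x
          simp only [q, G]
          rw [← Polynomial.coe_aeval_eq_eval, ← MvPolynomial.coe_aeval_eq_eval]
          change ((Polynomial.aeval x).comp (MvPolynomial.aeval _)) P = _
          rw [MvPolynomial.comp_aeval]
          simp
        have hqd : q.natDegree ≤ n := by
          have := MvPolynomial.aeval_natDegree_le (m := P.totalDegree) P le_rfl
            (fun i => Polynomial.C (a i) * Polynomial.X + Polynomial.C (y i))
            (fun i => Polynomial.natDegree_linear_le)
          exact this.trans (by simpa using hP)
        have := h v hv ε hε q hqd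
        simp only [hq] at this
        exact this
    _ = K / √(v:ℝ) * ∫ y, √(∫ x, (G (x, y)) ^ 2 ∂(gaussianReal 0 v)) ∂ν := integral_const_mul _ _
    _ ≤ _ := by gcongr

lemma exists_pos_lower_bound {Ω : Type*} [MeasurableSpace Ω] (Pr : Measure Ω)
    (ξ : Ω → C(Set.Icc (0 : ℝ) 1, ℝ))
    (hL2 : ∀ t, MemLp (fun ω => ξ ω t) 2 Pr)
    (hvar : ∀ t : Set.Icc (0 : ℝ) 1, 0 < ∫ ω, (ξ ω t) ^ 2 ∂Pr)
    (c γ : ℝ) (hγ : 0 < γ)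
    (hinc : ∀ t₁ t₂ : Set.Icc (0 : ℝ) 1,
      ∫ ω, (ξ ω t₂ - ξ ω t₁) ^ 2 ∂Pr ≤ c * |(t₂ : ℝ) - (t₁ : ℝ)| ^ γ) :
    ∃ s : ℝ, 0 < s ∧ ∀ t : Set.Icc (0 : ℝ) 1, s ≤ ∫ ω, (ξ ω t) ^ 2 ∂Pr := by
  have key : ∀ s t : Set.Icc (0 : ℝ) 1, ∫ ω, (ξ ω s) ^ 2 ∂Pr ≤
      2 * ∫ ω, (ξ ω t) ^ 2 ∂Pr + 2 * (c * |(t : ℝ) - (s : ℝ)| ^ γ) := by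
    intro s t
    have i1 := (hL2 t).integrable_sq
    have i2 := ((hL2 t).sub (hL2 s)).integrable_sq
    simp only [Pi.sub_apply] at i2
    calc _ ≤ ∫ ω, (2 * (ξ ω t) ^ 2 + 2 * (ξ ω t - ξ ω s) ^ 2) ∂Pr := by
          refine integral_mono (hL2 s).integrable_sq ((i1.const_mul 2).add (i2.const_mul 2)) ?_
          intro ω
          simp only
          nlinarith [sq_nonneg (2 * ξ ω t - ξ ω s)]
      _ = 2 * ∫ ω, (ξ ω t) ^ 2 ∂Pr + 2 * ∫ ω, (ξ ω t - ξ ω s) ^ 2 ∂Pr := by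
          rw [integral_add (i1.const_mul 2) (i2.const_mul 2), integral_const_mul, integral_const_mul]
      _ ≤ _ := by gcongr; exact hinc s t
  have := (isCompact_univ (X := Set.Icc (0 : ℝ) 1)).induction_on
    (p := fun A => ∃ s : ℝ, 0 < s ∧ ∀ t ∈ A, s ≤ ∫ ω, (ξ ω t) ^ 2 ∂Pr)
    ⟨1, one_pos, by simp⟩
    (fun A B hAB ⟨s, hs, h⟩ => ⟨s, hs, fun t ht => h t (hAB ht)⟩)
    (fun A B ⟨s, hs, h⟩ ⟨s', hs', h'⟩ => ⟨min s s', lt_min hs hs', fun t ht => ht.elim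
      (fun ht => (min_le_left _ _).trans (h t ht)) (fun ht => (min_le_right _ _).trans (h' t ht))⟩)
    (fun s _ => by
      have hs := hvar s
      have hcont : Continuous (fun t : Set.Icc (0 : ℝ) 1 => 2 * (c * |(t : ℝ) - (s : ℝ)| ^ γ)) := by
        have : Continuous (fun t : Set.Icc (0 : ℝ) 1 => |(t : ℝ) - (s : ℝ)|) := by fun_prop
        exact continuous_const.mul (continuous_const.mul (this.rpow_const fun _ => Or.inr hγ.le))
      have hev := hcont.continuousAt.eventually_lt (x₀ := s)
        (g := fun _ => (∫ ω, (ξ ω s) ^ 2 ∂Pr) / 2) continuousAt_const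
        (by simp [Real.zero_rpow hγ.ne']; exact hs)
      refine ⟨_, mem_nhdsWithin_of_mem_nhds hev, (∫ ω, (ξ ω s) ^ 2 ∂Pr) / 4, by positivity, ?_⟩
      intro t ht
      have h1 := key s t
      have h2 : 2 * (c * |(t : ℝ) - (s : ℝ)| ^ γ) < (∫ ω, (ξ ω s) ^ 2 ∂Pr) / 2 := ht
      linarith)
  obtain ⟨s, hs, h⟩ := this
  exact ⟨s, hs, fun t => h t trivial⟩

/-- for a centered Gaussian process `ξ` with continuous paths,
non-degenerate variances and Hölder second moments of increments, the family of
measures `Φ_ε μ` is uniformly finitely absolutely continuous with respect to the law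
`μ` of `ξ`. -/
theorem uniform_finAbsCont_of_local_time_approx
    {Ω : Type*} [MeasurableSpace Ω] (Pr : Measure Ω) [IsProbabilityMeasure Pr]
    (ξ : Ω → C(Set.Icc (0 : ℝ) 1, ℝ)) (hξ : Measurable ξ)
    -- ξ is a centered Gaussian process (its law is a centered Gaussian measure)
    (hgauss : ∀ ℓ : C(Set.Icc (0 : ℝ) 1, ℝ) →L[ℝ] ℝ, ∃ v : ℝ≥0,
      (Measure.map ξ Pr).map ℓ = gaussianReal 0 v)
    -- non-degenerate variances : E ξ(t)² > 0
    (hvar : ∀ t : Set.Icc (0 : ℝ) 1, 0 < ∫ ω, (ξ ω t) ^ 2 ∂Pr)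
    -- Hölder second moments of increments
    (c γ : ℝ) (hc : 0 < c) (hγ : 0 < γ)
    (hinc : ∀ t₁ t₂ : Set.Icc (0 : ℝ) 1,
      ∫ ω, (ξ ω t₂ - ξ ω t₁) ^ 2 ∂Pr ≤ c * |(t₂ : ℝ) - (t₁ : ℝ)| ^ γ) :
    ∀ n : ℕ, ∃ cn : ℝ, 0 < cn ∧ ∀ ε : ℝ, 0 < ε →
      ∀ P : MvPolynomial (Fin n) ℝ, P.totalDegree ≤ n →
        ∀ ℓ : Fin n → (C(Set.Icc (0 : ℝ) 1, ℝ) →L[ℝ] ℝ),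
          |∫ ω, PhiEps ε (ξ ω) * MvPolynomial.eval (fun i => ℓ i (ξ ω)) P ∂Pr| ≤
            cn * (∫ ω, (MvPolynomial.eval (fun i => ℓ i (ξ ω)) P) ^ 2 ∂Pr) ^ (1 / 2 : ℝ) := by
  intro n
  have hIG : IsGaussian (Measure.map ξ Pr) := ⟨fun L => by
    obtain ⟨v, hv⟩ := hgauss L
    have e1 : ∫ x, L x ∂(Measure.map ξ Pr) = 0 := by
      have : ∫ x, x ∂((Measure.map ξ Pr).map L) = 0 := by rw [hv]; simp
      rwa [integral_map (by fun_prop) (by fun_prop)] at this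
    have e2 : Var[L; Measure.map ξ Pr] = v := by
      have : Var[id; (Measure.map ξ Pr).map L] = v := by rw [hv]; simp
      rwa [variance_map (by fun_prop) (by fun_prop)] at this
    rw [e1, e2, hv]; simp⟩
  have hG : HasGaussianLaw ξ Pr := ⟨hIG⟩
  have hGt : ∀ t, HasGaussianLaw (fun ω => ξ ω t) Pr := fun t =>
    hG.map (ContinuousMap.evalCLM ℝ t)
  have hlaw : ∀ t, ∃ v : ℝ≥0, Pr.map (fun ω => ξ ω t) = gaussianReal 0 v ∧
      ∫ ω, (ξ ω t) ^ 2 ∂Pr = v := by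
    intro t
    obtain ⟨v, hv⟩ := hgauss (ContinuousMap.evalCLM ℝ t)
    rw [Measure.map_map (by fun_prop) hξ] at hv
    have hv' : Pr.map (fun ω => ξ ω t) = gaussianReal 0 v := hv
    refine ⟨v, hv', ?_⟩
    have h0 : ∫ ω, ξ ω t ∂Pr = 0 := by
      have : ∫ x, x ∂(Pr.map (fun ω => ξ ω t)) = 0 := by rw [hv']; simp
      rwa [integral_map (hGt t).aemeasurable (by fun_prop)] at this
    have h1 : Var[id; Pr.map (fun ω => ξ ω t)] = v := by rw [hv']; simp
    rw [variance_map (by fun_prop) (hGt t).aemeasurable,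
      variance_of_integral_eq_zero (by exact (hGt t).aemeasurable) (by exact h0)] at h1
    exact h1
  obtain ⟨s, hs, hsle⟩ := exists_pos_lower_bound Pr ξ (fun t => (hGt t).memLp_two) hvar c γ hγ hinc
  obtain ⟨K, hK, hKb⟩ := pair_bound n Pr
  refine ⟨K / √s, by positivity, fun ε hε P hP ℓ => ?_⟩
  rw [← Real.sqrt_eq_rpow]
  set Q : Ω → ℝ := fun ω => MvPolynomial.eval (fun i => ℓ i (ξ ω)) P with hQ
  have hAll : AllLp Q Pr :=
    AllLp.eval (f := fun i ω => ℓ i (ξ ω)) (fun i p => (hG.map (ℓ i)).memLp (by simp)) P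
  have hQ1 : Integrable Q Pr := memLp_one_iff_integrable.1 (hAll 1)
  have : IsProbabilityMeasure (volume : Measure (Set.Icc (0:ℝ) 1)) :=
    inferInstanceAs (IsProbabilityMeasure (volume : Measure unitInterval))
  have hev : Measurable (fun z : Ω × Set.Icc (0:ℝ) 1 => ξ z.1 z.2) := by
    have h1 : Continuous (fun z : C(Set.Icc (0 : ℝ) 1, ℝ) × Set.Icc (0:ℝ) 1 => z.1 z.2) :=
      continuous_eval
    exact h1.measurable.comp ((hξ.comp measurable_fst).prodMk measurable_snd)
  have hIntegr : Integrable (fun z : Ω × Set.Icc (0:ℝ) 1 => gaussDens1 ε (ξ z.1 z.2) * Q z.1)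
      (Pr.prod volume) := by
    refine (hQ1.comp_fst volume).bdd_mul
      ((continuous_gaussDens1 ε).measurable.comp hev).aestronglyMeasurable
      (ae_of_all _ fun z => gaussDens1_abs_le ε hε _)
  have hswap : ∫ ω, PhiEps ε (ξ ω) * Q ω ∂Pr =
      ∫ t : Set.Icc (0:ℝ) 1, ∫ ω, gaussDens1 ε (ξ ω t) * Q ω ∂Pr := by
    rw [← integral_integral_swap (f := fun ω t => gaussDens1 ε (ξ ω t) * Q ω) hIntegr]
    simp only [PhiEps, integral_mul_const]
  rw [hswap, ← Real.norm_eq_abs]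
  refine (norm_integral_le_of_norm_le_const (C := K / √s * √(∫ ω, Q ω ^ 2 ∂Pr))
    (ae_of_all _ fun t => ?_)).trans (by simp [hQ])
  obtain ⟨v, hv, hv2⟩ := hlaw t
  have hsv : s ≤ v := hv2 ▸ hsle t
  have hv0 : v ≠ 0 := by
    rintro rfl
    exact absurd hsv (by simpa using hs)
  have hpair : HasGaussianLaw (fun ω => (ξ ω t, fun i => ℓ i (ξ ω))) Pr :=
    hG.map ((ContinuousMap.evalCLM ℝ t).prod (ContinuousLinearMap.pi ℓ))
  refine (hKb v hv0 ε hε _ _ hpair hv P hP).trans ?_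
  simp only [hQ]
  gcongr
end
end

section
/- Let B be a real separable Banach space and μ a Borel probability measure on B having all weak moments. Let (ν_j)_{j≥1} be a sequence of Borel probability measures on B, each having all weak moments and each finitely absolutely continuous with respect to μ with the same constants (c_n)_{n≥0}. If ν_j converges weakly to a probability measure ν, then ν has all weak moments, for every finite-dimensional polynomial Q on B one has ∫_B Q dν_j → ∫_B Q dν, and ν is finitely absolutely continuous with respect to μ with the same constants (c_n)_{n≥0}. -/
open MeasureTheory ProbabilityTheory Real Filter
open scoped NNReal ENNReal Topology

noncomputable section

/-- Weak convergence plus bounded second moments gives convergence of first moments. -/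
lemma weak_aux {B : Type*} [NormedAddCommGroup B] [MeasurableSpace B] [BorelSpace B]
    (νs : ℕ → ProbabilityMeasure B) (ν : ProbabilityMeasure B)
    (hconv : Tendsto νs atTop (𝓝 ν)) (f : B → ℝ) (hf : Continuous f) (K : ℝ)
    (hint : ∀ j, Integrable (fun ω => f ω ^ 2) (νs j : Measure B))
    (hK : ∀ j, ∫ ω, f ω ^ 2 ∂(νs j : Measure B) ≤ K) :
    Integrable f (ν : Measure B) ∧
    Tendsto (fun j => ∫ ω, f ω ∂(νs j : Measure B)) atTop (𝓝 (∫ ω, f ω ∂(ν : Measure B))) := by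
  rw [ProbabilityMeasure.tendsto_iff_forall_integral_tendsto] at hconv
  have bdd : ∀ (g : B → ℝ), Continuous g → ∀ M : ℝ, (∀ x, |g x| ≤ M) →
      Tendsto (fun j => ∫ ω, g ω ∂(νs j : Measure B)) atTop (𝓝 (∫ ω, g ω ∂(ν : Measure B))) := by
    intro g hg M hM
    exact hconv (BoundedContinuousFunction.ofNormedAddCommGroup g hg M hM)
  have bint : ∀ (ρ : ProbabilityMeasure B) (g : B → ℝ), Continuous g → ∀ M : ℝ,
      (∀ x, |g x| ≤ M) → Integrable g (ρ : Measure B) := by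
    intro ρ g hg M hM
    exact Integrable.of_bound hg.aestronglyMeasurable M (Eventually.of_forall hM)
  have hK0 : 0 ≤ K := (integral_nonneg (fun ω => sq_nonneg (f ω))).trans (hK 0)
  -- truncations of the square
  have htr : ∀ n : ℕ, ∫ ω, min (f ω ^ 2) (n : ℝ) ∂(ν : Measure B) ≤ K := by
    intro n
    have hc : Continuous (fun ω => min (f ω ^ 2) (n : ℝ)) := by fun_prop
    have hb : ∀ x, |min (f x ^ 2) (n : ℝ)| ≤ n := by
      intro x
      rw [abs_of_nonneg (le_min (sq_nonneg _) (Nat.cast_nonneg n))]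
      exact min_le_right _ _
    refine le_of_tendsto (bdd _ hc n hb) (Eventually.of_forall fun j => ?_)
    refine le_trans (integral_mono (bint _ _ hc n hb) (hint j) ?_) (hK j)
    intro x
    exact min_le_left _ _
  have hlin : ∫⁻ ω, ENNReal.ofReal (f ω ^ 2) ∂(ν : Measure B) ≤ ENNReal.ofReal K := by
    have hlim : Tendsto (fun n : ℕ => ∫⁻ ω, ENNReal.ofReal (min (f ω ^ 2) (n : ℝ)) ∂(ν : Measure B))
        atTop (𝓝 (∫⁻ ω, ENNReal.ofReal (f ω ^ 2) ∂(ν : Measure B))) := by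
      apply lintegral_tendsto_of_tendsto_of_monotone
      · intro n
        have hc : Continuous (fun ω => min (f ω ^ 2) (n : ℝ)) := by fun_prop
        exact hc.measurable.ennreal_ofReal.aemeasurable
      · refine Eventually.of_forall fun x => ?_
        intro a b hab
        have : (a : ℝ) ≤ b := by exact_mod_cast hab
        exact ENNReal.ofReal_le_ofReal (min_le_min_left _ this)
      · refine Eventually.of_forall fun x => ?_
        obtain ⟨N, hN⟩ := exists_nat_ge (f x ^ 2)
        refine tendsto_const_nhds.congr' ?_
        filter_upwards [eventually_ge_atTop N] with n hn
        have : (N : ℝ) ≤ n := by exact_mod_cast hn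
        rw [min_eq_left (hN.trans this)]
    refine le_of_tendsto hlim (Eventually.of_forall fun n => ?_)
    have hc : Continuous (fun ω => min (f ω ^ 2) (n : ℝ)) := by fun_prop
    have h0 : ∀ x, 0 ≤ min (f x ^ 2) (n : ℝ) := fun x => le_min (sq_nonneg _) (Nat.cast_nonneg n)
    have hb : ∀ x, |min (f x ^ 2) (n : ℝ)| ≤ n := by
      intro x
      rw [abs_of_nonneg (h0 x)]
      exact min_le_right _ _
    rw [← ofReal_integral_eq_lintegral_ofReal (bint _ _ hc n hb) (Eventually.of_forall h0)]
    exact ENNReal.ofReal_le_ofReal (htr n)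
  have hsq : Integrable (fun ω => f ω ^ 2) (ν : Measure B) := by
    refine ⟨(hf.pow 2).aestronglyMeasurable, ?_⟩
    rw [hasFiniteIntegral_iff_ofReal (Eventually.of_forall fun x => sq_nonneg (f x))]
    exact lt_of_le_of_lt hlin ENNReal.ofReal_lt_top
  have fint : ∀ ρ : ProbabilityMeasure B, Integrable (fun ω => f ω ^ 2) (ρ : Measure B) →
      Integrable f (ρ : Measure B) := by
    intro ρ h
    exact ((memLp_two_iff_integrable_sq hf.aestronglyMeasurable).2 h).integrable (by norm_num)
  have hKν : ∫ ω, f ω ^ 2 ∂(ν : Measure B) ≤ K := by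
    rw [integral_eq_lintegral_of_nonneg_ae (Eventually.of_forall fun x => sq_nonneg (f x))
      (hf.pow 2).aestronglyMeasurable]
    exact ENNReal.toReal_le_of_le_ofReal hK0 hlin
  refine ⟨fint ν hsq, ?_⟩
  -- truncation error
  have err : ∀ M : ℝ, 0 < M → ∀ ρ : ProbabilityMeasure B,
      Integrable (fun ω => f ω ^ 2) (ρ : Measure B) →
      ∫ ω, f ω ^ 2 ∂(ρ : Measure B) ≤ K →
      |∫ ω, f ω ∂(ρ : Measure B) - ∫ ω, max (-M) (min M (f ω)) ∂(ρ : Measure B)| ≤ K / M := by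
    intro M hM ρ h1 h2
    have hc : Continuous (fun ω => max (-M) (min M (f ω))) := by fun_prop
    have hb : ∀ x, |max (-M) (min M (f x))| ≤ M := by
      intro x
      rw [abs_le]
      exact ⟨le_max_left _ _, max_le (by linarith) (min_le_left _ _)⟩
    rw [← integral_sub (fint ρ h1) (bint ρ _ hc M hb)]
    refine (abs_integral_le_integral_abs).trans ?_
    have : ∫ ω, |f ω - max (-M) (min M (f ω))| ∂(ρ : Measure B) ≤
        ∫ ω, f ω ^ 2 / M ∂(ρ : Measure B) := by
      refine integral_mono ((fint ρ h1).sub (bint ρ _ hc M hb)).abs (h1.div_const M) ?_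
      intro x
      change |f x - max (-M) (min M (f x))| ≤ f x ^ 2 / M
      rw [le_div_iff₀ hM]
      rcases le_total M (f x) with h | h
      · rw [min_eq_left h, max_eq_right (by linarith), abs_of_nonneg (by linarith)]
        nlinarith
      · rw [min_eq_right h]
        rcases le_total (-M) (f x) with h' | h'
        · rw [max_eq_right h']
          simp [sq_nonneg]
        · rw [max_eq_left h', abs_of_nonpos (by linarith)]
          nlinarith
    refine this.trans ?_
    rw [integral_div]
    exact div_le_div_of_nonneg_right h2 hM.le
  rw [Metric.tendsto_atTop]
  intro ε hε
  have hM : 0 < 4 * (K + 1) / ε := by positivity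
  set M := 4 * (K + 1) / ε with hMdef
  have hKM : K / M ≤ ε / 4 := by
    rw [div_le_iff₀ hM, hMdef]
    field_simp
    linarith
  have hc : Continuous (fun ω => max (-M) (min M (f ω))) := by fun_prop
  have hb : ∀ x, |max (-M) (min M (f x))| ≤ M := by
    intro x
    rw [abs_le]
    exact ⟨le_max_left _ _, max_le (by linarith) (min_le_left _ _)⟩
  obtain ⟨N, hN⟩ := Metric.tendsto_atTop.1 (bdd _ hc M hb) (ε / 4) (by positivity)
  refine ⟨N, fun j hj => ?_⟩
  have e1 := abs_le.1 (err M hM (νs j) (hint j) (hK j))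
  have e2 := abs_le.1 (err M hM ν hsq hKν)
  have e3 := hN j hj
  rw [Real.dist_eq, abs_lt] at e3 ⊢
  constructor <;> linarith [e1.1, e1.2, e2.1, e2.2, e3.1, e3.2]

lemma poly_memLp {B : Type*} [NormedAddCommGroup B] [NormedSpace ℝ B]
    [MeasurableSpace B] [BorelSpace B] (ρ : Measure B) [IsProbabilityMeasure ρ]
    (hmom : ∀ (ℓ : B →L[ℝ] ℝ) (k : ℕ), Integrable (fun ω => |ℓ ω| ^ k) ρ)
    (n : ℕ) (P : MvPolynomial (Fin n) ℝ) (ℓ : Fin n → (B →L[ℝ] ℝ)) :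
    ∀ q : ℕ, q ≠ 0 → MemLp (fun ω => MvPolynomial.eval (fun i => ℓ i ω) P) q ρ := by
  induction P using MvPolynomial.induction_on with
  | C a =>
    intro q _
    simpa using memLp_const a
  | add p r hp hr =>
    intro q hq
    simp only [map_add]
    exact (hp q hq).add (hr q hq)
  | mul_X p i hp =>
    intro q hq
    have h1 := hp (2 * q) (by omega)
    have h2 : MemLp (fun ω => ℓ i ω) ((2 * q : ℕ) : ℝ≥0∞) ρ := by
      rw [← integrable_norm_rpow_iff (ℓ i).continuous.aestronglyMeasurable
        (by simpa using hq) (ENNReal.natCast_ne_top _)]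
      have h := hmom (ℓ i) (2 * q)
      simp only [ENNReal.toReal_natCast, Real.rpow_natCast, Real.norm_eq_abs]
      exact h
    have : ENNReal.HolderTriple ((2 * q : ℕ) : ℝ≥0∞) ((2 * q : ℕ) : ℝ≥0∞) (q : ℝ≥0∞) := by
      constructor
      push_cast
      rw [ENNReal.mul_inv (by simp) (by simp), ← add_mul, ENNReal.inv_two_add_inv_two, one_mul]
    simpa using h2.mul' (r := (q : ℝ≥0∞)) h1

/-- finite absolute continuity with fixed constants is stable under weak
convergence: if each `ν_j` is finitely absolutely continuous w.r.t. `μ` with constants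
`c` and `ν_j → ν` weakly, then `ν` has all weak moments, integrals of finite-dimensional
polynomials converge, and `ν` is finitely absolutely continuous w.r.t. `μ` with the same
constants. -/
theorem finAbsCont_stable_under_weak_convergence
    {B : Type*} [NormedAddCommGroup B] [NormedSpace ℝ B] [CompleteSpace B]
    [TopologicalSpace.SeparableSpace B] [MeasurableSpace B] [BorelSpace B]
    (μ : Measure B) [IsProbabilityMeasure μ]
    -- μ has all weak moments
    (hμmom : ∀ (ℓ : B →L[ℝ] ℝ) (k : ℕ), Integrable (fun ω => |ℓ ω| ^ k) μ)
    (νs : ℕ → ProbabilityMeasure B) (ν : ProbabilityMeasure B)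
    -- each ν_j has all weak moments
    (hνmom : ∀ (j : ℕ) (ℓ : B →L[ℝ] ℝ) (k : ℕ),
      Integrable (fun ω => |ℓ ω| ^ k) (νs j : Measure B))
    (c : ℕ → ℝ)
    (hfac : ∀ j : ℕ, FinAbsCont (νs j : Measure B) μ c)
    -- ν_j converges weakly to ν
    (hconv : Tendsto νs atTop (𝓝 ν)) :
    (∀ (ℓ : B →L[ℝ] ℝ) (k : ℕ), Integrable (fun ω => |ℓ ω| ^ k) (ν : Measure B)) ∧
    (∀ (n : ℕ) (P : MvPolynomial (Fin n) ℝ) (ℓ : Fin n → (B →L[ℝ] ℝ)),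
      Tendsto (fun j : ℕ => ∫ ω, MvPolynomial.eval (fun i => ℓ i ω) P ∂(νs j : Measure B))
        atTop (𝓝 (∫ ω, MvPolynomial.eval (fun i => ℓ i ω) P ∂(ν : Measure B)))) ∧
    FinAbsCont (ν : Measure B) μ c := by
  have key : ∀ (n : ℕ) (P : MvPolynomial (Fin n) ℝ) (ℓ : Fin n → (B →L[ℝ] ℝ)),
      Integrable (fun ω => MvPolynomial.eval (fun i => ℓ i ω) P) (ν : Measure B) ∧
      Tendsto (fun j : ℕ => ∫ ω, MvPolynomial.eval (fun i => ℓ i ω) P ∂(νs j : Measure B))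
        atTop (𝓝 (∫ ω, MvPolynomial.eval (fun i => ℓ i ω) P ∂(ν : Measure B))) := by
    intro n P ℓ
    have hcont : Continuous (fun ω => MvPolynomial.eval (fun i => ℓ i ω) P) :=
      (MvPolynomial.continuous_eval P).comp (continuous_pi fun i => (ℓ i).continuous)
    -- regard `P ^ 2` as a polynomial in `N` variables
    let N := n + 2 * P.totalDegree
    let e : Fin n → Fin N := Fin.castLE (Nat.le_add_right _ _)
    have he : Function.Injective e := Fin.castLE_injective _
    let ℓ' : Fin N → (B →L[ℝ] ℝ) := Function.extend e ℓ 0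
    have hℓ' : ∀ i, ℓ' (e i) = ℓ i := fun i => he.extend_apply ℓ 0 i
    have hdeg : (MvPolynomial.rename e (P ^ 2)).totalDegree ≤ N :=
      (MvPolynomial.totalDegree_rename_le e (P ^ 2)).trans
        ((MvPolynomial.totalDegree_pow P 2).trans (Nat.le_add_left _ _))
    have hev : ∀ ω, MvPolynomial.eval (fun i => ℓ' i ω) (MvPolynomial.rename e (P ^ 2)) =
        (MvPolynomial.eval (fun i => ℓ i ω) P) ^ 2 := by
      intro ω
      rw [MvPolynomial.eval_rename, map_pow]
      congr 3
      funext i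
      simp [hℓ']
    refine weak_aux νs ν hconv _ hcont
      (c N * (∫ ω, (MvPolynomial.eval (fun i => ℓ' i ω)
        (MvPolynomial.rename e (P ^ 2))) ^ 2 ∂μ) ^ (1 / 2 : ℝ)) ?_ ?_
    · intro j
      have := poly_memLp (νs j : Measure B) (hνmom j) n P ℓ 2 (by norm_num)
      exact (memLp_two_iff_integrable_sq hcont.aestronglyMeasurable).1 (by exact_mod_cast this)
    · intro j
      have h := hfac j N _ hdeg ℓ'
      refine le_trans (le_of_eq ?_) ((le_abs_self _).trans h)
      simp only [hev]
  refine ⟨?_, fun n P ℓ => (key n P ℓ).2, ?_⟩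
  · intro ℓ k
    have h := (key 1 (MvPolynomial.X 0 ^ k) (fun _ => ℓ)).1.abs
    simpa [abs_pow] using h
  · intro n P hP ℓ
    exact le_of_tendsto (key n P ℓ).2.abs (Eventually.of_forall fun j => hfac j n P hP ℓ)
end
end

section
/- Let (X₁,…,X_k, Y) be a centered Gaussian random vector in ℝ^{k+1} and let P : ℝ^k → ℝ be a polynomial of total degree at most n. Then there exists a polynomial Q : ℝ → ℝ of degree at most n such that E[P(X₁,…,X_k) | Y] = Q(Y) almost surely. -/
open MeasureTheory ProbabilityTheory Real
open scoped NNReal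

noncomputable section

/-- Functions in every `L^p`, `p` a natural number, are closed under products. -/
lemma memLp_nat_mul {Ω : Type*} [MeasurableSpace Ω] {μ : Measure Ω} {f g : Ω → ℝ}
    (hf : ∀ p : ℕ, MemLp f p μ) (hg : ∀ p : ℕ, MemLp g p μ) :
    ∀ p : ℕ, MemLp (f * g) p μ := by
  intro p
  have hh : ENNReal.HolderTriple ((2 * p : ℕ) : ENNReal) ((2 * p : ℕ) : ENNReal) (p : ENNReal) := by
    constructor
    push_cast
    rw [ENNReal.mul_inv (by simp) (by simp), ← add_mul, ENNReal.inv_two_add_inv_two, one_mul]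
  exact MemLp.mul (hg (2 * p)) (hf (2 * p))

lemma memLp_nat_pow {Ω : Type*} [MeasurableSpace Ω] {μ : Measure Ω} [IsProbabilityMeasure μ]
    {f : Ω → ℝ} (hf : ∀ p : ℕ, MemLp f p μ) (n : ℕ) :
    ∀ p : ℕ, MemLp (f ^ n) p μ := by
  induction n with
  | zero => intro p; rw [pow_zero]; exact memLp_const 1
  | succ n ih => rw [pow_succ]; exact memLp_nat_mul ih hf

lemma memLp_nat_prod {Ω : Type*} [MeasurableSpace Ω] {μ : Measure Ω} [IsProbabilityMeasure μ]
    {ι : Type*} (s : Finset ι) {f : ι → Ω → ℝ} (hf : ∀ i, ∀ p : ℕ, MemLp (f i) p μ) :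
    ∀ p : ℕ, MemLp (∏ i ∈ s, f i) p μ := by
  classical
  induction s using Finset.induction_on with
  | empty => intro p; rw [Finset.prod_empty]; exact memLp_const 1
  | insert a s ha ih => rw [Finset.prod_insert ha]; exact memLp_nat_mul (hf a) ih

/-- Substituting polynomials of degree at most one does not raise the total degree. -/
lemma totalDegree_aeval_le_of_le_one {σ τ : Type*} (g : σ → MvPolynomial τ ℝ)
    (hg : ∀ i, (g i).totalDegree ≤ 1) (P : MvPolynomial σ ℝ) :
    (MvPolynomial.aeval g P).totalDegree ≤ P.totalDegree := by
  rw [MvPolynomial.aeval_def, MvPolynomial.eval₂_eq]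
  refine MvPolynomial.totalDegree_finsetSum_le fun d hd => ?_
  refine (MvPolynomial.totalDegree_mul _ _).trans ?_
  rw [MvPolynomial.algebraMap_eq, MvPolynomial.totalDegree_C, zero_add]
  refine (MvPolynomial.totalDegree_finsetProd _ _).trans ?_
  refine le_trans ?_ (MvPolynomial.le_totalDegree hd)
  refine Finset.sum_le_sum fun i _ => ?_
  refine (MvPolynomial.totalDegree_pow _ _).trans ?_
  exact (Nat.mul_le_mul_left _ (hg i)).trans (by simp)

/-- Conditional expectation of a polynomial in independent `Z`, `Y`. -/
lemma condExp_indep_polynomial {Ω : Type*} [MeasurableSpace Ω] (Pr : Measure Ω)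
    [IsProbabilityMeasure Pr] (k n : ℕ) (Z : Fin k → Ω → ℝ) (Y : Ω → ℝ)
    (hZm : ∀ i, Measurable (Z i)) (hYm : Measurable Y)
    (hZ : ∀ i, ∀ p : ℕ, MemLp (Z i) p Pr) (hY : ∀ p : ℕ, MemLp Y p Pr)
    (hind : IndepFun (fun ω i => Z i ω) Y Pr)
    (R : MvPolynomial (Option (Fin k)) ℝ) (hR : R.totalDegree ≤ n) :
    ∃ Q : Polynomial ℝ, Q.natDegree ≤ n ∧
      Pr[fun ω => MvPolynomial.eval (fun o => o.elim (Y ω) (fun i => Z i ω)) R |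
          MeasurableSpace.comap Y inferInstance] =ᵐ[Pr] fun ω => Q.eval (Y ω) := by
  let M : (Option (Fin k) →₀ ℕ) → Ω → ℝ := fun d => ∏ i, Z i ^ d (some i)
  have hM : ∀ d, ∀ p : ℕ, MemLp (M d) p Pr := fun d =>
    memLp_nat_prod _ fun i => memLp_nat_pow (hZ i) _
  have hYj : ∀ j : ℕ, ∀ p : ℕ, MemLp (Y ^ j) p Pr := fun j => memLp_nat_pow hY j
  have hMi : ∀ d, Integrable (M d) Pr := fun d => by
    simpa [memLp_one_iff_integrable] using hM d 1
  have hYMi : ∀ d, Integrable (Y ^ d none * M d) Pr := fun d => by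
    simpa [memLp_one_iff_integrable] using memLp_nat_mul (hYj (d none)) (hM d) 1
  have hterm : ∀ d, Pr[Y ^ d none * M d | MeasurableSpace.comap Y inferInstance] =ᵐ[Pr] fun ω => Y ω ^ d none * ∫ x, M d x ∂Pr := by
    intro d
    have hYs : StronglyMeasurable[MeasurableSpace.comap Y inferInstance] (Y ^ d none) :=
      (Measurable.pow_const (comap_measurable Y) (d none)).stronglyMeasurable
    have h1 := condExp_mul_of_stronglyMeasurable_left hYs (hYMi d) (hMi d)
    have hi : Indep (MeasurableSpace.comap (fun ω i => Z i ω) inferInstance)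
        (MeasurableSpace.comap Y inferInstance) Pr :=
      (IndepFun_iff_Indep _ _ _).1 hind
    have hMs : StronglyMeasurable[MeasurableSpace.comap (fun ω i => Z i ω) inferInstance] (M d) := by
      have hc : Measurable (fun z : Fin k → ℝ => ∏ i, z i ^ d (some i)) := by fun_prop
      have he : M d = (fun z : Fin k → ℝ => ∏ i, z i ^ d (some i)) ∘ (fun ω i => Z i ω) := by
        ext ω; simp [M]
      rw [he]
      exact (hc.comp (comap_measurable _)).stronglyMeasurable
    have h2 := condExp_indep_eq (μ := Pr) (measurable_pi_lambda _ hZm).comap_le hYm.comap_le hMs hi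
    filter_upwards [h1, h2] with ω h1 h2
    rw [h1, Pi.mul_apply, h2]; rfl
  have hexp : (fun ω => MvPolynomial.eval (fun o => o.elim (Y ω) (fun i => Z i ω)) R)
      = ∑ d ∈ R.support, (R.coeff d) • (Y ^ d none * M d) := by
    ext ω
    rw [MvPolynomial.eval_eq']
    simp [M, Fintype.prod_option]
  refine ⟨∑ d ∈ R.support, Polynomial.C (R.coeff d * ∫ x, M d x ∂Pr) * Polynomial.X ^ d none,
    ?_, ?_⟩
  · refine Polynomial.natDegree_sum_le_of_forall_le _ _ fun d hd => ?_
    refine (Polynomial.natDegree_C_mul_X_pow_le _ _).trans ?_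
    refine le_trans ?_ ((MvPolynomial.le_totalDegree hd).trans hR)
    by_cases h0 : d none = 0
    · simp [h0]
    · exact Finset.single_le_sum (f := fun i => d i) (fun _ _ => Nat.zero_le _)
        (Finsupp.mem_support_iff.2 h0)
  · rw [hexp]
    have h1 := condExp_finsetSum (μ := Pr) (s := R.support)
      (f := fun d => (R.coeff d) • (Y ^ d none * M d)) (fun d _ => (hYMi d).smul _)
      (MeasurableSpace.comap Y inferInstance)
    have h2 : ∀ᵐ ω ∂Pr, ∀ d ∈ R.support, (Pr[(R.coeff d) • (Y ^ d none * M d) | MeasurableSpace.comap Y inferInstance]) ω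
        = R.coeff d * (Y ω ^ d none * ∫ x, M d x ∂Pr) := by
      rw [Finset.eventually_all]
      intro d _
      filter_upwards [condExp_smul (μ := Pr) (R.coeff d) (Y ^ d none * M d)
        (MeasurableSpace.comap Y inferInstance), hterm d] with ω a b
      rw [a, Pi.smul_apply, b, smul_eq_mul]
    filter_upwards [h1, h2] with ω h1 h2
    rw [h1, Finset.sum_apply, Finset.sum_congr rfl h2, Polynomial.eval_finsetSum]
    refine Finset.sum_congr rfl fun d _ => ?_
    simp
    ring

/-- for a centered Gaussian random vector `(X₁,…,X_k, Y)` and a polynomial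
`P` of total degree at most `n` in `k` variables, the conditional expectation
`E[P(X₁,…,X_k) | Y]` is almost surely a polynomial of degree at most `n` in `Y`. -/
theorem condexp_polynomial_of_gaussian_is_polynomial
    {Ω : Type*} [MeasurableSpace Ω] (Pr : Measure Ω) [IsProbabilityMeasure Pr]
    (k n : ℕ) (X : Fin k → Ω → ℝ) (Y : Ω → ℝ)
    (hXm : ∀ i, Measurable (X i)) (hYm : Measurable Y)
    -- (X₁,…,X_k,Y) is a centered Gaussian random vector : every linear combination of
    -- the coordinates is a centered Gaussian random variable
    (hgauss : ∀ (a : Fin k → ℝ) (b : ℝ), ∃ v : ℝ≥0,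
      Measure.map (fun ω => (∑ i, a i * X i ω) + b * Y ω) Pr = gaussianReal 0 v)
    (P : MvPolynomial (Fin k) ℝ) (hP : P.totalDegree ≤ n) :
    ∃ Q : Polynomial ℝ, Q.natDegree ≤ n ∧
      Pr[fun ω => MvPolynomial.eval (fun i => X i ω) P |
          MeasurableSpace.comap Y inferInstance] =ᵐ[Pr] fun ω => Q.eval (Y ω) := by
  -- the joint law is Gaussian
  have hjoint : ∀ c : Fin k → ℝ, HasGaussianLaw
      (fun ω => ((fun i => X i ω - c i * Y ω), (fun _ : Unit => Y ω))) Pr := by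
    intro c
    refine ⟨isGaussian_of_map_eq_gaussianReal fun L => ?_⟩
    let a : Fin k → ℝ := fun i => L (Pi.single i 1, 0)
    let b : ℝ := L (0, fun _ => 1)
    obtain ⟨v, hv⟩ := hgauss a (b - ∑ i, a i * c i)
    refine ⟨0, v, ?_⟩
    rw [← hv, Measure.map_map (by fun_prop) (by fun_prop)]
    congr 1
    ext ω
    have hL : ∀ (z : Fin k → ℝ) (y : ℝ), L (z, fun _ => y) = ∑ i, a i * z i + b * y := by
      intro z y
      have hz : ((z, fun _ => y) : (Fin k → ℝ) × (Unit → ℝ))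
          = ∑ i, z i • ((Pi.single i 1, 0) : (Fin k → ℝ) × (Unit → ℝ))
            + y • ((0, fun _ => 1) : (Fin k → ℝ) × (Unit → ℝ)) := by
        ext j
        · simp [Prod.fst_sum, Finset.sum_apply, Pi.single_apply]
        · simp [Prod.snd_sum]
      rw [hz, map_add, map_sum]
      simp only [map_smul, smul_eq_mul]
      simp only [a, b, mul_comm]
    rw [Function.comp_apply, hL]
    simp only [mul_sub, Finset.sum_sub_distrib, sub_mul, Finset.sum_mul, mul_assoc]
    ring
  have h0 := hjoint 0
  have hY2 : MemLp Y 2 Pr := (h0.snd.eval ()).memLp_two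
  have hX2 : ∀ i, MemLp (X i) 2 Pr := fun i => by simpa using (h0.fst.eval i).memLp_two
  let c : Fin k → ℝ := fun i => cov[X i, Y; Pr] / Var[Y; Pr]
  have hc := hjoint c
  let Z : Fin k → Ω → ℝ := fun i ω => X i ω - c i * Y ω
  have hcov : ∀ i, cov[Z i, Y; Pr] = 0 := by
    intro i
    have : cov[Z i, Y; Pr] = cov[X i, Y; Pr] - c i * Var[Y; Pr] := by
      rw [covariance_fun_sub_left (hX2 i) (hY2.const_mul _) hY2, covariance_const_mul_left,
        covariance_self hYm.aemeasurable]
    rw [this]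
    by_cases hv : Var[Y; Pr] = 0
    · have hYc : ∀ᵐ ω ∂Pr, Y ω = Pr[Y] := by
        have h1 : eVar[Y; Pr] = 0 := by
          rw [← hY2.ofReal_variance_eq, hv, ENNReal.ofReal_zero]
        exact (evariance_eq_zero_iff hYm.aemeasurable).1 h1
      have : cov[X i, Y; Pr] = 0 := by
        rw [covariance]
        refine integral_eq_zero_of_ae ?_
        filter_upwards [hYc] with ω h
        simp [← h]
      rw [this, hv]; simp
    · simp only [c]; field_simp; simp
  have hind : IndepFun (fun ω i => Z i ω) Y Pr := by
    have h := HasGaussianLaw.indepFun_of_covariance_eval (X := Z) (Y := fun _ : Unit => Y) hc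
      (fun i _ => hcov i)
    exact h.comp (φ := id) (ψ := fun y : Unit → ℝ => y ()) measurable_id (measurable_pi_apply _)
  have hgd : ∀ i, (MvPolynomial.X (some i) + MvPolynomial.C (c i) * MvPolynomial.X none :
      MvPolynomial (Option (Fin k)) ℝ).totalDegree ≤ 1 := by
    intro i
    refine (MvPolynomial.totalDegree_add _ _).trans (max_le (by simp) ?_)
    refine (MvPolynomial.totalDegree_mul _ _).trans (by simp)
  obtain ⟨Q, hQ, hQe⟩ := condExp_indep_polynomial Pr k n Z Y
    (fun i => (hXm i).sub (hYm.const_mul _)) hYm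
    (fun i p => (hc.fst.eval i).memLp (by simp)) (fun p => (hc.snd.eval ()).memLp (by simp)) hind
    (MvPolynomial.aeval (fun i => MvPolynomial.X (some i)
      + MvPolynomial.C (c i) * MvPolynomial.X none) P)
    ((totalDegree_aeval_le_of_le_one _ hgd P).trans hP)
  refine ⟨Q, hQ, ?_⟩
  convert hQe using 3 with ω
  rw [← MvPolynomial.coe_aeval_eq_eval, ← MvPolynomial.coe_aeval_eq_eval, RingHom.coe_coe,
    RingHom.coe_coe, ← AlgHom.comp_apply, MvPolynomial.comp_aeval]
  congr 2
  ext i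
  simp [Z]
end
end
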